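/- Fix 0 < γ < 1 and let 𝒮 = {(x₁,x₂,x₃) ∈ ℝ³ : x₂² + x₃² ≤ x₁^γ, x₁ > 0}. Let p : ℝ³ → [1,∞) be a measurable exponent such that 3 < ess inf_{ℝ³∖𝒮} p ≤ ess sup_{ℝ³∖𝒮} p < 9/2 and 9/2 < ess inf_𝒮 p ≤ ess sup_𝒮 p < (6γ+3)/(2γ). If (u, P) is a weak solution of the stationary Navier–Stokes equations on ℝ³ with u ∈ L^{p(·)}(ℝ³) and P ∈ L^{p(·)/2}(ℝ³), then u = 0 almost everywhere. -/

import Mathlib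

open MeasureTheory Filter Metric
open scoped ENNReal Topology NNReal

noncomputable section

/-- `ℝ³` as a Euclidean space (coordinates `x 0, x 1, x 2` standing for `x₁, x₂, x₃`). -/
abbrev E3 : Type := EuclideanSpace ℝ (Fin 3)

/-- Partial derivative `∂ᵢ g` of a scalar function on `ℝ³`. -/
def pd (i : Fin 3) (g : E3 → ℝ) (x : E3) : ℝ :=
  fderiv ℝ g x (EuclideanSpace.single i 1)

/-- Laplacian of a scalar function on `ℝ³`. -/
def lap3 (g : E3 → ℝ) (x : E3) : ℝ := ∑ i : Fin 3, pd i (pd i g) x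

/-- The modular `ρ_{p(·)}(f) = ∫ |f|^{p(x)} dx` for a finite real-valued variable exponent. -/
def modularV (p : E3 → ℝ) (f : E3 → ℝ) : ℝ≥0∞ :=
  ∫⁻ x, ENNReal.ofReal (|f x| ^ p x)

/-- Membership in the variable exponent Lebesgue space `L^{p(·)}(ℝ³)`
(finiteness of the Luxemburg norm). -/
def MemVarLp (p : E3 → ℝ) (f : E3 → ℝ) : Prop :=
  ∃ l : ℝ, 0 < l ∧ modularV p (fun x => f x / l) ≤ 1

/-- The Luxemburg norm `‖f‖_{L^{p(·)}(ℝ³)}`. -/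
def varLpNorm (p : E3 → ℝ) (f : E3 → ℝ) : ℝ :=
  sInf {l : ℝ | 0 < l ∧ modularV p (fun x => f x / l) ≤ 1}

/-- `(u, P)` is a weak solution of the stationary Navier–Stokes equations
`Δu − (u·∇)u − ∇P = 0`, `div u = 0` on `ℝ³`. -/
def IsWeakSolutionNS (u : E3 → E3) (P : E3 → ℝ) : Prop :=
  (∀ φ : E3 → E3, ContDiff ℝ (⊤ : ℕ∞) φ → HasCompactSupport φ →
      ((∫ x, ∑ j : Fin 3, u x j * lap3 (fun y => φ y j) x) +
        (∑ i : Fin 3, ∑ j : Fin 3, ∫ x, u x i * u x j * pd i (fun y => φ y j) x) +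
        (∫ x, P x * ∑ j : Fin 3, pd j (fun y => φ y j) x) = 0)) ∧
  (∀ ψ : E3 → ℝ, ContDiff ℝ (⊤ : ℕ∞) ψ → HasCompactSupport ψ →
      (∫ x, ∑ j : Fin 3, u x j * pd j ψ x) = 0)

/-- The infinite cylinder `𝒞 = {x ∈ ℝ³ : x₂² + x₃² ≤ 1}`. -/
def cylC : Set E3 := {x | (x 1) ^ 2 + (x 2) ^ 2 ≤ 1}


/-- The paraboloid-like region `𝒮 = {x ∈ ℝ³ : x₂² + x₃² ≤ x₁^γ, x₁ > 0}`. -/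
def setS (γ : ℝ) : Set E3 := {x | 0 < x 0 ∧ (x 1) ^ 2 + (x 2) ^ 2 ≤ (x 0) ^ γ}

abbrev Smo (g : E3 → ℝ) : Prop := ContDiff ℝ (⊤ : ℕ∞) g

lemma Smo.diffAt {g : E3 → ℝ} (hg : Smo g) (x : E3) : DifferentiableAt ℝ g x :=
  (hg.differentiable (by simp)) x

lemma Smo.pd {g : E3 → ℝ} (hg : Smo g) (i : Fin 3) : Smo (pd i g) := by
  have h : ContDiff ℝ (⊤ : ℕ∞) (fderiv ℝ g) := hg.fderiv_right (by simp)
  exact h.clm_apply contDiff_const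

lemma Smo.lap {g : E3 → ℝ} (hg : Smo g) : Smo (lap3 g) := by
  unfold lap3
  exact ContDiff.sum fun i _ => (hg.pd i).pd i

lemma pd_add {f g : E3 → ℝ} (hf : Smo f) (hg : Smo g) (i : Fin 3) :
    pd i (fun x => f x + g x) = fun x => pd i f x + pd i g x := by
  ext x
  simp only [_root_.pd]
  rw [fderiv_fun_add (hf.diffAt x) (hg.diffAt x)]; rfl

lemma pd_sub {f g : E3 → ℝ} (hf : Smo f) (hg : Smo g) (i : Fin 3) :
    pd i (fun x => f x - g x) = fun x => pd i f x - pd i g x := by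
  ext x
  simp only [_root_.pd]
  rw [fderiv_fun_sub (hf.diffAt x) (hg.diffAt x)]; rfl

lemma pd_mul {f g : E3 → ℝ} (hf : Smo f) (hg : Smo g) (i : Fin 3) (x : E3) :
    pd i (fun x => f x * g x) x = f x * pd i g x + pd i f x * g x := by
  simp only [_root_.pd]
  rw [fderiv_fun_mul (hf.diffAt x) (hg.diffAt x)]
  simp; ring

lemma pd_const_mul {f : E3 → ℝ} (hf : Smo f) (c : ℝ) (i : Fin 3) :
    pd i (fun x => c * f x) = fun x => c * pd i f x := by
  ext x
  simp only [_root_.pd]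
  rw [fderiv_const_mul (hf.diffAt x)]; rfl

lemma pd_zero (i : Fin 3) : pd i (fun _ => (0:ℝ)) = fun _ => 0 := by
  ext x; simp [_root_.pd]

lemma pd_sum {ι : Type*} (s : Finset ι) {f : ι → E3 → ℝ} (hf : ∀ k, Smo (f k)) (i : Fin 3) :
    pd i (fun x => ∑ k ∈ s, f k x) = fun x => ∑ k ∈ s, pd i (f k) x := by
  ext x
  simp only [_root_.pd]
  rw [fderiv_fun_sum (fun k _ => (hf k).diffAt x)]
  simp

lemma pd_comm {g : E3 → ℝ} (hg : Smo g) (i j : Fin 3) : pd i (pd j g) = pd j (pd i g) := by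
  ext x
  have h : ContDiff ℝ (⊤ : ℕ∞) (fderiv ℝ g) := hg.fderiv_right (by simp)
  have hs : IsSymmSndFDerivAt ℝ g x :=
    hg.contDiffAt.isSymmSndFDerivAt (by
      rw [minSmoothness_of_isRCLikeNormedField]
      exact WithTop.coe_le_coe.2 (le_top : (2 : ℕ∞) ≤ ⊤))
  have key : ∀ a b : Fin 3, pd a (pd b g) x
      = fderiv ℝ (fderiv ℝ g) x (EuclideanSpace.single a 1) (EuclideanSpace.single b 1) := by
    intro a b
    have hd : DifferentiableAt ℝ (fderiv ℝ g) x := (h.differentiable (by simp)) x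
    change fderiv ℝ (fun y => fderiv ℝ g y (EuclideanSpace.single b 1)) x _ = _
    rw [fderiv_clm_apply hd (by fun_prop)]
    simp
  rw [key, key]
  exact hs _ _

lemma cs_pd {g : E3 → ℝ} (hg : HasCompactSupport g) (i : Fin 3) : HasCompactSupport (pd i g) :=
  hg.fderiv_apply (𝕜 := ℝ) _

lemma cs_lap {g : E3 → ℝ} (hg : HasCompactSupport g) : HasCompactSupport (lap3 g) := by
  have h : ∀ i : Fin 3, HasCompactSupport (pd i (pd i g)) := fun i => cs_pd (cs_pd hg i) i
  have : lap3 g = (pd 0 (pd 0 g) + pd 1 (pd 1 g)) + pd 2 (pd 2 g) := by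
    ext x; simp [lap3, Fin.sum_univ_three]
  rw [this]
  exact ((h 0).add (h 1)).add (h 2)

lemma pd_comp_sub (g : E3 → ℝ) (a : E3) (i : Fin 3) :
    pd i (fun y => g (y - a)) = fun y => pd i g (y - a) := by
  ext y
  simp only [_root_.pd]
  rw [fderiv_comp_sub]

lemma pd_comp_rsub {g : E3 → ℝ} (hg : Smo g) (a : E3) (i : Fin 3) :
    pd i (fun y => g (a - y)) = fun y => - pd i g (a - y) := by
  ext y
  simp only [_root_.pd]
  have h2 : HasFDerivAt (fun y : E3 => a - y) (-(ContinuousLinearMap.id ℝ E3)) y := by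
    simpa using (hasFDerivAt_id y).const_sub a
  have h1 := (hg.diffAt (a - y)).hasFDerivAt.comp y h2
  have : (fun y => g (a - y)) = g ∘ (fun y => a - y) := rfl
  rw [this, h1.fderiv]
  simp

lemma pd_comp_smul {g : E3 → ℝ} (hg : Smo g) (c : ℝ) (i : Fin 3) :
    pd i (fun y => g (c • y)) = fun y => c * pd i g (c • y) := by
  ext y
  simp only [_root_.pd]
  have h2 : HasFDerivAt (fun y : E3 => c • y) (c • (ContinuousLinearMap.id ℝ E3)) y := by
    exact (hasFDerivAt_id y).const_smul c
  have h1 := (hg.diffAt (c • y)).hasFDerivAt.comp y h2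
  have : (fun y => g (c • y)) = g ∘ (fun y => c • y) := rfl
  rw [this, h1.fderiv]
  simp

lemma Smo.comp_sub {g : E3 → ℝ} (hg : Smo g) (a : E3) : Smo (fun y => g (y - a)) :=
  hg.comp (contDiff_id.sub contDiff_const)
lemma Smo.comp_rsub {g : E3 → ℝ} (hg : Smo g) (a : E3) : Smo (fun y => g (a - y)) :=
  hg.comp (contDiff_const.sub contDiff_id)
lemma Smo.comp_smul {g : E3 → ℝ} (hg : Smo g) (c : ℝ) : Smo (fun y => g (c • y)) :=
  hg.comp (contDiff_const_smul c)

lemma cs_comp_sub {g : E3 → ℝ} (hg : HasCompactSupport g) (a : E3) :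
    HasCompactSupport (fun y => g (y - a)) :=
  hg.comp_homeomorph (Homeomorph.subRight a)
lemma cs_comp_rsub {g : E3 → ℝ} (hg : HasCompactSupport g) (a : E3) :
    HasCompactSupport (fun y => g (a - y)) :=
  hg.comp_homeomorph (Homeomorph.subLeft a)

lemma lap_comp_sub (g : E3 → ℝ) (a : E3) :
    lap3 (fun y => g (y - a)) = fun y => lap3 g (y - a) := by
  ext y
  simp only [lap3, pd_comp_sub]

lemma pd_congr {f g : E3 → ℝ} {x : E3} (h : f =ᶠ[𝓝 x] g) (i : Fin 3) : pd i f =ᶠ[𝓝 x] pd i g := by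
  filter_upwards [h.fderiv (𝕜 := ℝ)] with y hy
  simp [_root_.pd, hy]

lemma int_of_cs {g : E3 → ℝ} (hg : Continuous g) (hc : HasCompactSupport g) : Integrable g :=
  hg.integrable_of_hasCompactSupport hc

lemma ibp {f g : E3 → ℝ} (hf : Smo f) (hg : Smo g) (hc : HasCompactSupport g) (i : Fin 3) :
    ∫ x, f x * pd i g x = - ∫ x, pd i f x * g x := by
  refine integral_mul_fderiv_eq_neg_fderiv_mul_of_integrable ?_ ?_ ?_
    (fun x _ => hf.diffAt x) (fun x _ => hg.diffAt x)
  · exact int_of_cs ((hf.pd i).continuous.mul hg.continuous) hc.mul_left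
  · exact int_of_cs (hf.continuous.mul (hg.pd i).continuous) (cs_pd hc i).mul_left
  · exact int_of_cs (hf.continuous.mul hg.continuous) hc.mul_left

lemma int_pd_zero {g : E3 → ℝ} (hg : Smo g) (hc : HasCompactSupport g) (i : Fin 3) :
    ∫ x, pd i g x = 0 := by
  have := ibp (f := fun _ => (1:ℝ)) contDiff_const hg hc i
  simpa [_root_.pd] using this

lemma smo_coord (i : Fin 3) : Smo (fun z : E3 => z i) :=
  (EuclideanSpace.proj (𝕜 := ℝ) i).contDiff

lemma pd_coord (i : Fin 3) (z : E3) : pd i (fun z : E3 => z i) z = 1 := by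
  have h : HasFDerivAt (fun z : E3 => z i) (EuclideanSpace.proj (𝕜 := ℝ) i) z :=
    (EuclideanSpace.proj (𝕜 := ℝ) i).hasFDerivAt
  simp [_root_.pd, h.fderiv]

lemma smo_rad {F : ℝ → ℝ} (hF : ContDiff ℝ (⊤ : ℕ∞) F) : Smo (fun z : E3 => F (‖z‖ ^ 2)) :=
  hF.comp (contDiff_norm_sq ℝ)

lemma smo_deriv {F : ℝ → ℝ} (hF : ContDiff ℝ (⊤ : ℕ∞) F) : ContDiff ℝ (⊤ : ℕ∞) (deriv F) := by
  have h : ContDiff ℝ (⊤ : ℕ∞) (fderiv ℝ F) := hF.fderiv_right (by simp)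
  have : deriv F = fun x => fderiv ℝ F x 1 := by ext x; simp
  rw [this]
  exact h.clm_apply contDiff_const

lemma pd_rad {F : ℝ → ℝ} (hF : ContDiff ℝ (⊤ : ℕ∞) F) (i : Fin 3) :
    pd i (fun z : E3 => F (‖z‖ ^ 2)) = fun z => z i * (2 * deriv F (‖z‖ ^ 2)) := by
  ext z
  have h1 : HasDerivAt F (deriv F (‖z‖ ^ 2)) (‖z‖ ^ 2) :=
    ((hF.differentiable (by simp)) _).hasDerivAt
  have h2 := (hasStrictFDerivAt_norm_sq z).hasFDerivAt
  have h3 := h1.comp_hasFDerivAt z h2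
  have : (fun z : E3 => F (‖z‖ ^ 2)) = F ∘ fun z => ‖z‖ ^ 2 := rfl
  simp only [_root_.pd]
  rw [this, h3.fderiv]
  simp [EuclideanSpace.inner_single_right]
  ring

def LF (F : ℝ → ℝ) (t : ℝ) : ℝ := 6 * deriv F t + 4 * t * deriv (deriv F) t

lemma smo_LF {F : ℝ → ℝ} (hF : ContDiff ℝ (⊤ : ℕ∞) F) : ContDiff ℝ (⊤ : ℕ∞) (LF F) := by
  unfold LF
  exact (contDiff_const.mul (smo_deriv hF)).add
    ((contDiff_const.mul contDiff_id).mul (smo_deriv (smo_deriv hF)))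

lemma lap_rad {F : ℝ → ℝ} (hF : ContDiff ℝ (⊤ : ℕ∞) F) :
    lap3 (fun z : E3 => F (‖z‖ ^ 2)) = fun z => LF F (‖z‖ ^ 2) := by
  ext z
  have hF' := smo_deriv hF
  have hr : Smo (fun z : E3 => 2 * deriv F (‖z‖ ^ 2)) := contDiff_const.mul (smo_rad hF')
  simp only [lap3, pd_rad hF]
  have : ∀ i : Fin 3, pd i (fun z : E3 => z i * (2 * deriv F (‖z‖ ^ 2))) z
      = 4 * (z i) ^ 2 * deriv (deriv F) (‖z‖ ^ 2) + 2 * deriv F (‖z‖ ^ 2) := by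
    intro i
    rw [pd_mul (smo_coord i) hr, pd_coord, pd_const_mul (smo_rad hF') 2 i, pd_rad hF']
    ring
  simp only [this]
  rw [LF, EuclideanSpace.real_norm_sq_eq]
  simp only [Fin.sum_univ_three]
  ring

/-- smooth function equal to `√t` for `t ≥ 1` -/
def Fk (t : ℝ) : ℝ := Real.smoothTransition (2 * t - 1) * Real.sqrt t

lemma Fk_smooth : ContDiff ℝ (⊤ : ℕ∞) Fk := by
  rw [contDiff_iff_contDiffAt]
  intro t
  by_cases ht : t < 1 / 2
  · have : Fk =ᶠ[𝓝 t] fun _ => 0 := by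
      filter_upwards [Iio_mem_nhds ht] with s hs
      have : Real.smoothTransition (2 * s - 1) = 0 :=
        Real.smoothTransition.zero_of_nonpos (by simp only [Set.mem_Iio] at hs; linarith)
      simp [Fk, this]
    exact contDiffAt_const.congr_of_eventuallyEq this
  · have h0 : t ≠ 0 := by intro h; apply ht; rw [h]; norm_num
    refine ContDiffAt.mul ?_ (Real.contDiffAt_sqrt h0)
    exact (Real.smoothTransition.contDiff (n := (⊤ : ℕ∞)).comp
      ((contDiff_const.mul contDiff_id).sub contDiff_const)).contDiffAt

lemma Fk_eq {t : ℝ} (ht : 1 ≤ t) : Fk t = Real.sqrt t := by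
  simp [Fk, Real.smoothTransition.one_of_one_le (show 1 ≤ 2 * t - 1 by linarith)]

lemma deriv_rpow_on {G : ℝ → ℝ} {c a : ℝ} (h : ∀ t, 1 < t → G t = c * t ^ a) :
    ∀ t, 1 < t → deriv G t = (c * a) * t ^ (a - 1) := by
  intro t ht
  have : G =ᶠ[𝓝 t] fun t => c * t ^ a := by
    filter_upwards [Ioi_mem_nhds ht] with s hs using h s hs
  rw [this.deriv_eq]
  have := (Real.hasDerivAt_rpow_const (p := a) (Or.inl (by linarith : t ≠ 0))).const_mul c
  rw [this.deriv]; ring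

lemma LF_rpow {G : ℝ → ℝ} {c a : ℝ} (h : ∀ t, 1 < t → G t = c * t ^ a) :
    ∀ t, 1 < t → LF G t = (c * a * (4 * a + 2)) * t ^ (a - 1) := by
  intro t ht
  have h1 := deriv_rpow_on h
  have h2 := deriv_rpow_on h1
  rw [LF, h1 t ht, h2 t ht]
  have : t ^ (a - 1) = t * t ^ (a - 1 - 1) := by
    rw [Real.rpow_sub_one (by linarith) (a - 1)]; field_simp
  rw [this]; ring

lemma G_eq : ∀ t, 1 < t → LF Fk t = 2 * t ^ (-(1/2) : ℝ) := by
  intro t ht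
  rw [LF_rpow (c := 1) (a := 1/2) (G := Fk) ?_ t ht]
  · norm_num
  · intro s hs
    rw [Fk_eq hs.le, Real.sqrt_eq_rpow, one_mul]

lemma LG_eq : ∀ t, 1 < t → LF (LF Fk) t = 0 := by
  intro t ht
  rw [LF_rpow G_eq t ht]; norm_num

lemma DG_eq : deriv (LF Fk) 4 = - 1 / 8 := by
  rw [deriv_rpow_on G_eq 4 (by norm_num)]
  have : (4:ℝ) ^ (-(1/2) - 1 : ℝ) = 1 / 8 := by
    rw [show (4:ℝ) = 2 ^ (2:ℝ) by norm_num, ← Real.rpow_mul (by norm_num)]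
    norm_num
  rw [this]; norm_num

lemma mass_rad : ∫ z : E3, LF (LF Fk) (‖z‖ ^ 2) ≠ 0 := by
  have hG := smo_LF Fk_smooth
  rw [integral_fun_norm_addHaar volume (fun y => LF (LF Fk) (y ^ 2))]
  simp only [finrank_euclideanSpace, Fintype.card_fin, smul_eq_mul, nsmul_eq_mul]
  have hI : ∫ y in Set.Ioi (0:ℝ), y ^ (3 - 1) * LF (LF Fk) (y ^ 2) = -2 := by
    have h1 : ∫ y in Set.Ioi (0:ℝ), y ^ (3 - 1) * LF (LF Fk) (y ^ 2)
        = ∫ y in Set.Ioc (0:ℝ) 2, y ^ (3 - 1) * LF (LF Fk) (y ^ 2) := by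
      refine (setIntegral_eq_of_subset_of_forall_sdiff_eq_zero measurableSet_Ioi
        (fun y hy => hy.1) ?_)
      intro y hy
      have : 2 < y := by
        by_contra hh
        exact hy.2 ⟨hy.1, not_lt.1 hh⟩
      rw [LG_eq _ (by nlinarith), mul_zero]
    rw [h1, ← intervalIntegral.integral_of_le (by norm_num)]
    have hd : ∀ y ∈ Set.uIcc (0:ℝ) 2, HasDerivAt (fun y => 2 * y ^ 3 * deriv (LF Fk) (y ^ 2))
        (y ^ (3 - 1) * LF (LF Fk) (y ^ 2)) y := by
      intro y _
      have a1 : HasDerivAt (fun y : ℝ => 2 * y ^ 3) (2 * (3 * y ^ 2)) y := by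
        simpa using (hasDerivAt_pow 3 y).const_mul 2
      have a2 : HasDerivAt (fun y : ℝ => y ^ 2) (2 * y) y := by
        simpa using (hasDerivAt_pow 2 y)
      have a3 : HasDerivAt (deriv (LF Fk)) (deriv (deriv (LF Fk)) (y ^ 2)) (y ^ 2) :=
        (((smo_deriv hG).differentiable (by simp)) _).hasDerivAt
      have a4 := a1.mul (HasDerivAt.comp y (h₂ := deriv (LF Fk)) (h := fun y => y ^ 2) a3 a2)
      have a5 : HasDerivAt (fun y : ℝ => 2 * y ^ 3 * deriv (LF Fk) (y ^ 2)) _ y := a4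
      refine a5.congr_deriv ?_
      change _ = y ^ 2 * (6 * deriv (LF Fk) (y ^ 2) + 4 * y ^ 2 * deriv (deriv (LF Fk)) (y ^ 2))
      simp only [Function.comp_apply]
      ring
    rw [intervalIntegral.integral_eq_sub_of_hasDerivAt hd]
    · rw [show (2:ℝ) ^ 2 = 4 by norm_num, DG_eq]; norm_num
    · apply Continuous.intervalIntegrable
      exact (continuous_id.pow _).mul ((smo_LF hG).continuous.comp (continuous_id.pow 2))
  rw [hI]
  have : 0 < volume.real (ball (0:E3) 1) := by
    rw [measureReal_def]
    exact ENNReal.toReal_pos (measure_ball_pos _ _ one_pos).ne' measure_ball_lt_top.ne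
  have : 0 < (3:ℝ) * volume.real (ball (0:E3) 1) := by positivity
  push_cast
  intro h
  nlinarith

def Sk (z : E3) : ℝ := Fk (‖z‖ ^ 2)

lemma Sk_smo : Smo Sk := smo_rad Fk_smooth
lemma Sk_eq {z : E3} (hz : 1 ≤ ‖z‖) : Sk z = ‖z‖ := by
  rw [Sk, Fk_eq (by nlinarith), Real.sqrt_sq (norm_nonneg _)]
lemma Sk_bilap (z : E3) : lap3 (lap3 Sk) z = LF (LF Fk) (‖z‖ ^ 2) := by
  have : Sk = fun z => Fk (‖z‖ ^ 2) := rfl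
  rw [this, lap_rad Fk_smooth, lap_rad (smo_LF Fk_smooth)]
lemma Sk_bilap_zero {z : E3} (hz : 1 < ‖z‖) : lap3 (lap3 Sk) z = 0 := by
  rw [Sk_bilap, LG_eq _ (by nlinarith)]
lemma Sk_mass : ∫ z, lap3 (lap3 Sk) z ≠ 0 := by
  simp only [Sk_bilap]; exact mass_rad

lemma pd_scal {g : E3 → ℝ} (hg : Smo g) (a c : ℝ) (i : Fin 3) :
    pd i (fun z => a * g (c • z)) = fun z => (a * c) * pd i g (c • z) := by
  rw [pd_const_mul (hg.comp_smul c), pd_comp_smul hg]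
  ext z; ring

lemma lap_scal {g : E3 → ℝ} (hg : Smo g) (a c : ℝ) :
    lap3 (fun z => a * g (c • z)) = fun z => (a * c * c) * lap3 g (c • z) := by
  ext z
  simp only [lap3, pd_scal hg, Finset.mul_sum]
  refine Finset.sum_congr rfl fun i _ => ?_
  rw [pd_scal (hg.pd i)]

lemma lap_pd {g : E3 → ℝ} (hg : Smo g) (j : Fin 3) : lap3 (pd j g) = pd j (lap3 g) := by
  unfold lap3
  rw [pd_sum _ (fun k => (hg.pd k).pd k)]
  ext x
  refine Finset.sum_congr rfl fun i _ => ?_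
  rw [pd_comm hg i j, pd_comm (hg.pd i) i j]

lemma Sk_third : ∃ C : ℝ, 0 < C ∧ ∀ (i j k : Fin 3) (z : E3),
    ‖z‖ ^ 2 * |pd i (pd j (pd k Sk)) z| ≤ C := by
  have hb : ∀ i j k : Fin 3, ∃ M : ℝ, ∀ z ∈ closedBall (0:E3) 2, |pd i (pd j (pd k Sk)) z| ≤ M := by
    intro i j k
    obtain ⟨M, hM⟩ := (isCompact_closedBall (0:E3) 2).exists_bound_of_continuousOn
      ((((Sk_smo.pd k).pd j).pd i).continuous.continuousOn)
    exact ⟨M, hM⟩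
  choose M hM using hb
  set N : ℝ := 1 + ∑ i, ∑ j, ∑ k, |M i j k| with hN
  have hMN : ∀ i j k, M i j k ≤ N := by
    intro i j k
    have h1 : |M i j k| ≤ ∑ k, |M i j k| :=
      Finset.single_le_sum (f := fun k => |M i j k|) (fun _ _ => abs_nonneg _) (Finset.mem_univ k)
    have h2 : ∑ k, |M i j k| ≤ ∑ j, ∑ k, |M i j k| :=
      Finset.single_le_sum (f := fun j => ∑ k, |M i j k|)
        (fun _ _ => Finset.sum_nonneg fun _ _ => abs_nonneg _) (Finset.mem_univ j)
    have h3 : ∑ j, ∑ k, |M i j k| ≤ ∑ i, ∑ j, ∑ k, |M i j k| :=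
      Finset.single_le_sum (f := fun i => ∑ j, ∑ k, |M i j k|)
        (fun _ _ => Finset.sum_nonneg fun _ _ => Finset.sum_nonneg fun _ _ => abs_nonneg _)
        (Finset.mem_univ i)
    linarith [le_abs_self (M i j k)]
  have hN0 : 0 < N := by
    have : 0 ≤ ∑ i, ∑ j, ∑ k, |M i j k| := by positivity
    linarith
  refine ⟨4 * N, by positivity, ?_⟩
  intro i j k w
  by_cases hw : ‖w‖ ≤ 2
  · have := (hM i j k w (by simpa using hw)).trans (hMN i j k)
    have h4 : ‖w‖ ^ 2 ≤ 4 := by nlinarith [norm_nonneg w]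
    calc _ ≤ 4 * N := by gcongr
      _ = _ := rfl
  · push Not at hw
    set c : ℝ := ‖w‖ / 2 with hc
    have hc1 : 1 < c := by rw [hc]; linarith
    have hc0 : c ≠ 0 := by linarith
    set z : E3 := c⁻¹ • w with hz
    have hcz : c • z = w := by rw [hz, smul_smul, mul_inv_cancel₀ hc0, one_smul]
    have hzn : ‖z‖ = 2 := by
      rw [hz, norm_smul, norm_inv, Real.norm_of_nonneg (by linarith), hc]
      field_simp
    have hev : (fun y => 1 * Sk (c • y)) =ᶠ[𝓝 z] fun y => c * Sk y := by
      have : ∀ᶠ y in 𝓝 z, 1 < ‖y‖ :=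
        (continuous_norm.tendsto z).eventually (lt_mem_nhds (by rw [hzn]; norm_num))
      filter_upwards [this] with y hy
      have h2 : 1 ≤ ‖c • y‖ := by
        rw [norm_smul, Real.norm_of_nonneg (by linarith)]; nlinarith
      rw [Sk_eq hy.le, Sk_eq h2, norm_smul, Real.norm_of_nonneg (by linarith), one_mul]
    have h3 := (pd_congr (pd_congr (pd_congr hev k) j) i).eq_of_nhds
    rw [pd_scal Sk_smo, pd_scal (Sk_smo.pd k), pd_scal ((Sk_smo.pd k).pd j),
      pd_const_mul Sk_smo, pd_const_mul (Sk_smo.pd k), pd_const_mul ((Sk_smo.pd k).pd j)] at h3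
    simp only [hcz] at h3
    have h4 := (hM i j k z (by simp [hzn])).trans (hMN i j k)
    have h5 : c ^ 2 * pd i (pd j (pd k Sk)) w = pd i (pd j (pd k Sk)) z := by
      have : c * (c ^ 2 * pd i (pd j (pd k Sk)) w) = c * pd i (pd j (pd k Sk)) z := by
        rw [← h3]; ring
      exact mul_left_cancel₀ hc0 this
    have h6 : c ^ 2 * |pd i (pd j (pd k Sk)) w| ≤ N := by
      rw [← h5, abs_mul, abs_of_nonneg (by positivity)] at h4
      exact h4
    have : ‖w‖ = 2 * c := by rw [hc]; ring
    rw [this]; nlinarith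

def Hd (δ : ℝ) (z : E3) : ℝ := δ * Sk (δ⁻¹ • z) - Sk z

lemma Hd_smo (δ : ℝ) : Smo (Hd δ) := (contDiff_const.mul (Sk_smo.comp_smul _)).sub Sk_smo

lemma Hd_zero {δ : ℝ} (h0 : 0 < δ) (h1 : δ ≤ 1) {z : E3} (hz : 1 ≤ ‖z‖) : Hd δ z = 0 := by
  have h2 : ‖δ⁻¹ • z‖ = δ⁻¹ * ‖z‖ := by rw [norm_smul, Real.norm_of_nonneg (by positivity)]
  have h3 : 1 ≤ δ⁻¹ := (one_le_inv₀ h0).2 h1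
  rw [Hd, Sk_eq hz, Sk_eq (by rw [h2]; nlinarith), h2]
  field_simp; ring

lemma Hd_cs {δ : ℝ} (h0 : 0 < δ) (h1 : δ ≤ 1) : HasCompactSupport (Hd δ) := by
  refine HasCompactSupport.intro (isCompact_closedBall (0:E3) 1) fun z hz => Hd_zero h0 h1 ?_
  simp only [mem_closedBall, dist_zero_right, not_le] at hz
  exact hz.le

lemma Hd_bilap {δ : ℝ} (h0 : 0 < δ) :
    lap3 (lap3 (Hd δ)) = fun z => δ⁻¹ ^ 3 * lap3 (lap3 Sk) (δ⁻¹ • z) - lap3 (lap3 Sk) z := by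
  have hsub : ∀ f g : E3 → ℝ, Smo f → Smo g → lap3 (fun z => f z - g z)
      = fun z => lap3 f z - lap3 g z := by
    intro f g hf hg
    ext z
    simp only [lap3, pd_sub hf hg, ← Finset.sum_sub_distrib]
    refine Finset.sum_congr rfl fun i _ => ?_
    rw [pd_sub (hf.pd i) (hg.pd i)]
  have hs : Smo (fun z => δ * Sk (δ⁻¹ • z)) := contDiff_const.mul (Sk_smo.comp_smul _)
  have e : Hd δ = fun z => δ * Sk (δ⁻¹ • z) - Sk z := rfl
  rw [e, hsub _ _ hs Sk_smo, hsub _ _ hs.lap Sk_smo.lap, lap_scal Sk_smo, lap_scal Sk_smo.lap]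
  ext z
  field_simp

lemma Hd_third {C : ℝ} (hC : ∀ (i j k : Fin 3) (z : E3),
    ‖z‖ ^ 2 * |pd i (pd j (pd k Sk)) z| ≤ C) {δ : ℝ} (h0 : 0 < δ)
    (i j k : Fin 3) (z : E3) : ‖z‖ ^ 2 * |pd i (pd j (pd k (Hd δ))) z| ≤ 2 * C := by
  have hs : Smo (fun z => δ * Sk (δ⁻¹ • z)) := contDiff_const.mul (Sk_smo.comp_smul _)
  have e : Hd δ = fun z => δ * Sk (δ⁻¹ • z) - Sk z := rfl
  rw [e, pd_sub hs Sk_smo, pd_sub (hs.pd k) (Sk_smo.pd k),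
    pd_sub ((hs.pd k).pd j) ((Sk_smo.pd k).pd j),
    pd_scal Sk_smo, pd_scal (Sk_smo.pd k), pd_scal ((Sk_smo.pd k).pd j)]
  have h1 := hC i j k z
  have h2 := hC i j k (δ⁻¹ • z)
  rw [norm_smul, Real.norm_of_nonneg (by positivity)] at h2
  have h3 : |δ * δ⁻¹ * δ⁻¹ * δ⁻¹ * pd i (pd j (pd k Sk)) (δ⁻¹ • z)|
      = δ⁻¹ ^ 2 * |pd i (pd j (pd k Sk)) (δ⁻¹ • z)| := by
    rw [abs_mul, abs_of_nonneg (by positivity)]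
    field_simp
  have h4 := abs_sub (δ * δ⁻¹ * δ⁻¹ * δ⁻¹ * pd i (pd j (pd k Sk)) (δ⁻¹ • z))
    (pd i (pd j (pd k Sk)) z)
  rw [h3] at h4
  calc _ ≤ ‖z‖ ^ 2 * (δ⁻¹ ^ 2 * |pd i (pd j (pd k Sk)) (δ⁻¹ • z)| + |pd i (pd j (pd k Sk)) z|) := by
        gcongr
    _ ≤ 2 * C := by nlinarith

lemma Hd_third_zero {δ : ℝ} (h0 : 0 < δ) (h1 : δ ≤ 1) (i j k : Fin 3) {z : E3} (hz : 1 < ‖z‖) :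
    pd i (pd j (pd k (Hd δ))) z = 0 := by
  have hev : Hd δ =ᶠ[𝓝 z] fun _ => 0 := by
    have : ∀ᶠ y in 𝓝 z, 1 < ‖y‖ :=
      (continuous_norm.tendsto z).eventually (lt_mem_nhds hz)
    filter_upwards [this] with y hy using Hd_zero h0 h1 hy.le
  have h3 := (pd_congr (pd_congr (pd_congr hev k) j) i).eq_of_nhds
  rw [pd_zero, pd_zero, pd_zero] at h3
  exact h3

lemma int_mul_cs {f g : E3 → ℝ} (hf : LocallyIntegrable f) (hg : Continuous g)
    (hc : HasCompactSupport g) : Integrable (fun x => f x * g x) :=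
  hf.integrable_smul_right_of_hasCompactSupport hg hc

lemma weak_id {u : E3 → E3} {P : E3 → ℝ} (hw : IsWeakSolutionNS u P)
    (hu1 : ∀ j, LocallyIntegrable (fun x => u x j))
    {H : E3 → ℝ} (hH : Smo H) (hc : HasCompactSupport H) (j : Fin 3) :
    ∫ y, u y j * lap3 (lap3 H) y = ∑ i : Fin 3, ∑ l : Fin 3, ∫ y, u y i * u y l *
      (pd i (pd l (pd j H)) y - if l = j then pd i (lap3 H) y else 0) := by
  have hsm : ∀ l : Fin 3, Smo (fun y => pd l (pd j H) y - if l = j then lap3 H y else 0) := by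
    intro l
    by_cases h : l = j
    · simp only [h, if_true]; exact ((hH.pd j).pd j).sub hH.lap
    · simp only [h, if_false, sub_zero]; exact (hH.pd j).pd l
  have hcs : ∀ l : Fin 3,
      HasCompactSupport (fun y => pd l (pd j H) y - if l = j then lap3 H y else 0) := by
    intro l
    by_cases h : l = j
    · simp only [h, if_true]; exact (cs_pd (cs_pd hc j) j).sub (cs_lap hc)
    · simp only [h, if_false, sub_zero]; exact cs_pd (cs_pd hc j) l
  set φ : E3 → E3 := fun y => WithLp.toLp 2
    (fun l => pd l (pd j H) y - if l = j then lap3 H y else 0) with hφ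
  have hφs : ContDiff ℝ (⊤ : ℕ∞) φ := by
    rw [contDiff_euclidean]; exact hsm
  have hφc : HasCompactSupport φ := by
    have : HasCompactSupport (fun y => (fun l => pd l (pd j H) y - if l = j then lap3 H y else 0 :
        Fin 3 → ℝ)) := by
      obtain ⟨R, hR⟩ : ∃ R, ∀ (l : Fin 3) y, y ∉ closedBall (0:E3) R →
          pd l (pd j H) y - (if l = j then lap3 H y else 0) = 0 := by
        have : ∀ l : Fin 3, ∃ R, tsupport (fun y => pd l (pd j H) y - if l = j then lap3 H y else 0)
            ⊆ closedBall (0:E3) R := fun l =>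
          (hcs l).isCompact.isBounded.subset_closedBall 0
        choose R hR using this
        refine ⟨∑ l, |R l|, fun l y hy => ?_⟩
        refine image_eq_zero_of_notMem_tsupport (f := fun y => pd l (pd j H) y -
          if l = j then lap3 H y else 0) fun hh => hy ?_
        refine closedBall_subset_closedBall ?_ (hR l hh)
        exact (le_abs_self _).trans (Finset.single_le_sum (f := fun l => |R l|)
          (fun _ _ => abs_nonneg _) (Finset.mem_univ l))
      exact HasCompactSupport.intro (isCompact_closedBall (0:E3) R) fun y hy => by
        ext l; exact hR l y hy
    exact this.comp_left (g := fun v : Fin 3 → ℝ => (WithLp.toLp 2 v : E3)) (by ext; simp)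
  have h1 := hw.1 φ hφs hφc
  have e0 : ∀ l : Fin 3, (fun y => φ y l) = fun y => pd l (pd j H) y -
    if l = j then lap3 H y else 0 := fun l => rfl
  have e1 : ∀ (i l : Fin 3), pd i (fun y => φ y l) = fun y => pd i (pd l (pd j H)) y -
      if l = j then pd i (lap3 H) y else 0 := by
    intro i l
    rw [e0]
    by_cases h : l = j
    · simp only [h, if_true]; rw [pd_sub ((hH.pd j).pd j) hH.lap]
    · simp only [h, if_false, sub_zero]
  have e2 : ∀ l, lap3 (fun y => φ y l) = fun y => pd l (pd j (lap3 H)) y -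
      if l = j then lap3 (lap3 H) y else 0 := by
    intro l
    have : lap3 (fun y => φ y l) = fun y => lap3 (pd l (pd j H)) y -
        if l = j then lap3 (lap3 H) y else 0 := by
      ext y
      simp only [lap3, e1]
      by_cases h : l = j
      · simp only [h, if_true, ← Finset.sum_sub_distrib]
        refine Finset.sum_congr rfl fun i _ => ?_
        have := pd_sub (((hH.pd j).pd j).pd i) (hH.lap.pd i) i
        exact congrFun this y
      · simp only [h, if_false, sub_zero]
    rw [this, lap_pd (hH.pd j), lap_pd hH]
  have e3 : ∀ y, ∑ l : Fin 3, pd l (fun y => φ y l) y = 0 := by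
    intro y
    have hl : pd j (lap3 H) y = ∑ l : Fin 3, pd l (pd l (pd j H)) y := by
      rw [← lap_pd hH]; rfl
    simp only [e1, Finset.sum_sub_distrib, Finset.sum_ite_eq', Finset.mem_univ, if_true, hl,
      sub_self]
  simp only [e3, mul_zero, integral_zero, add_zero] at h1
  simp only [e2, e1] at h1
  have h2 := hw.2 (pd j (lap3 H)) (hH.lap.pd j) (cs_pd (cs_lap hc) j)
  have h3 : ∫ x, ∑ l : Fin 3, u x l * (pd l (pd j (lap3 H)) x -
      if l = j then lap3 (lap3 H) x else 0) = - ∫ x, u x j * lap3 (lap3 H) x := by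
    have : ∀ x, ∑ l : Fin 3, u x l * (pd l (pd j (lap3 H)) x -
        if l = j then lap3 (lap3 H) x else 0)
        = (∑ l : Fin 3, u x l * pd l (pd j (lap3 H)) x) - u x j * lap3 (lap3 H) x := by
      intro x
      simp only [mul_sub, Finset.sum_sub_distrib, mul_ite, mul_zero, Finset.sum_ite_eq',
        Finset.mem_univ, if_true]
    simp only [this]
    rw [integral_sub, h2, zero_sub]
    · exact integrable_finsetSum _ fun l _ => int_mul_cs (hu1 l) ((hH.lap.pd j).pd l).continuous
        (cs_pd (cs_pd (cs_lap hc) j) l)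
    · exact int_mul_cs (hu1 j) hH.lap.lap.continuous (cs_lap (cs_lap hc))
  rw [h3] at h1
  linarith

lemma kern_bound {a K : E3 → ℝ} {B : ℝ} (hB : 0 < B) (hK : ∀ z, ‖z‖ ^ 2 * |K z| ≤ B)
    (hK0 : ∀ z, 1 < ‖z‖ → K z = 0) {G : E3 → ℝ≥0∞} (ha : ∀ y, ‖a y‖ₑ ≤ G y) (x : E3) :
    ‖∫ y, a y * K (y - x)‖ₑ
      ≤ ENNReal.ofReal B * ∫⁻ y in closedBall x 1, (‖y - x‖ₑ ^ 2)⁻¹ * G y := by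
  have hKe : ∀ z, ‖K z‖ₑ ≤ ENNReal.ofReal B * (‖z‖ₑ ^ 2)⁻¹ := by
    intro z
    by_cases hz : z = 0
    · subst hz
      have : (ENNReal.ofReal B) ≠ 0 := by simpa using hB
      simp [ENNReal.mul_top this]
    · have hz' : 0 < ‖z‖ := norm_pos_iff.2 hz
      rw [← ofReal_norm z, ← ENNReal.ofReal_pow (norm_nonneg z),
        ← ENNReal.ofReal_inv_of_pos (by positivity), ← ENNReal.ofReal_mul hB.le,
        Real.enorm_eq_ofReal_abs]
      apply ENNReal.ofReal_le_ofReal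
      rw [← div_eq_mul_inv, le_div_iff₀ (by positivity)]
      linarith [hK z]
  calc ‖∫ y, a y * K (y - x)‖ₑ ≤ ∫⁻ y, ‖a y * K (y - x)‖ₑ := enorm_integral_le_lintegral_enorm _
    _ = ∫⁻ y in closedBall x 1, ‖a y * K (y - x)‖ₑ := by
        refine (setLIntegral_eq_of_support_subset ?_).symm
        intro y hy
        by_contra hh
        apply hy
        rw [mem_closedBall, dist_eq_norm, not_le] at hh
        simp [hK0 _ hh]
    _ ≤ ∫⁻ y in closedBall x 1, ENNReal.ofReal B * ((‖y - x‖ₑ ^ 2)⁻¹ * G y) := by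
        refine lintegral_mono fun y => ?_
        rw [enorm_mul]
        calc _ ≤ G y * (ENNReal.ofReal B * (‖y - x‖ₑ ^ 2)⁻¹) := mul_le_mul' (ha y) (hKe _)
          _ = _ := by ring
    _ = _ := lintegral_const_mul' _ _ ENNReal.ofReal_ne_top

/-- the Riesz-type potential -/
def Jp (G : E3 → ℝ≥0∞) (x : E3) : ℝ≥0∞ :=
  ∫⁻ y in closedBall x 1, (‖y - x‖ₑ ^ 2)⁻¹ * (G y) ^ 2

lemma coord_enorm_le (v : E3) (i : Fin 3) : ‖v i‖ₑ ≤ ‖v‖ₑ := by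
  rw [← ofReal_norm, ← ofReal_norm]
  exact ENNReal.ofReal_le_ofReal (PiLp.norm_apply_le v i)

lemma ker_bdd : ∃ M : ℝ, 0 < M ∧ ∀ z : E3, |lap3 (lap3 Sk) z| ≤ M := by
  obtain ⟨M, hM⟩ := (isCompact_closedBall (0:E3) 1).exists_bound_of_continuousOn
      (Sk_smo.lap.lap.continuous.continuousOn)
  refine ⟨|M| + 1, by positivity, fun z => ?_⟩
  by_cases hz : ‖z‖ ≤ 1
  · have := hM z (by simpa using hz)
    rw [Real.norm_eq_abs] at this
    linarith [le_abs_self M]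
  · rw [Sk_bilap_zero (not_le.1 hz)]; simp; positivity

lemma delta_bound {u : E3 → E3} {P : E3 → ℝ} (hw : IsWeakSolutionNS u P)
    (hu1 : ∀ j, LocallyIntegrable (fun x => u x j)) :
    ∃ C : ℝ≥0∞, C ≠ ∞ ∧ ∀ (j : Fin 3) (x : E3) (δ : ℝ), 0 < δ → δ ≤ 1 →
      ‖∫ y, u y j * (δ⁻¹ ^ 3 * lap3 (lap3 Sk) (δ⁻¹ • (y - x)))‖ₑ
        ≤ C * Jp (fun y => 1 + ‖u y‖ₑ) x := by
  obtain ⟨C, hC0, hC⟩ := Sk_third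
  obtain ⟨M, hM0, hM⟩ := ker_bdd
  refine ⟨9 * ENNReal.ofReal (8 * C) + ENNReal.ofReal M, ?_, ?_⟩
  · exact ENNReal.add_ne_top.2 ⟨ENNReal.mul_ne_top (by norm_num) ENNReal.ofReal_ne_top,
      ENNReal.ofReal_ne_top⟩
  intro j x δ h0 h1
  have hHs : Smo (fun y => Hd δ (y - x)) := (Hd_smo δ).comp_sub x
  have hid := weak_id hw hu1 hHs (cs_comp_sub (Hd_cs h0 h1) x) j
  simp only [lap_comp_sub, pd_comp_sub, Hd_bilap h0] at hid
  have hcont : Continuous (fun y : E3 => lap3 (lap3 Sk) (y - x)) :=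
    Sk_smo.lap.lap.continuous.comp (continuous_id.sub continuous_const)
  have hcontδ : Continuous (fun y : E3 => δ⁻¹ ^ 3 * lap3 (lap3 Sk) (δ⁻¹ • (y - x))) :=
    continuous_const.mul (Sk_smo.lap.lap.continuous.comp
      (by fun_prop : Continuous fun y : E3 => δ⁻¹ • (y - x)))
  have hcs0 : HasCompactSupport (lap3 (lap3 Sk)) :=
    HasCompactSupport.intro (isCompact_closedBall (0:E3) 1) fun z hz => Sk_bilap_zero (by
      simpa using hz)
  have hcs : HasCompactSupport (fun y : E3 => lap3 (lap3 Sk) (y - x)) := cs_comp_sub hcs0 x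
  have hcsδ : HasCompactSupport (fun y : E3 => δ⁻¹ ^ 3 * lap3 (lap3 Sk) (δ⁻¹ • (y - x))) := by
    refine HasCompactSupport.mul_left ?_
    exact cs_comp_sub (g := fun z => lap3 (lap3 Sk) (δ⁻¹ • z))
      (hcs0.comp_smul (inv_ne_zero h0.ne')) x
  have hsplit : ∫ y, u y j * (δ⁻¹ ^ 3 * lap3 (lap3 Sk) (δ⁻¹ • (y - x)))
      = (∑ i : Fin 3, ∑ l : Fin 3, ∫ y, u y i * u y l *
      (pd i (pd l (pd j (Hd δ))) (y - x) - if l = j then pd i (lap3 (Hd δ)) (y - x) else 0))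
      + ∫ y, u y j * lap3 (lap3 Sk) (y - x) := by
    rw [← hid, ← integral_add]
    · congr 1; ext y; ring
    · simp only [mul_sub]
      exact (int_mul_cs (hu1 j) hcontδ hcsδ).sub (int_mul_cs (hu1 j) hcont hcs)
    · exact int_mul_cs (hu1 j) hcont hcs
  rw [hsplit]
  have hg1 : ∀ (i l : Fin 3) (y : E3), ‖u y i * u y l‖ₑ ≤ (1 + ‖u y‖ₑ) ^ 2 := by
    intro i l y
    rw [enorm_mul, sq]
    exact mul_le_mul' ((coord_enorm_le _ _).trans le_add_self)
      ((coord_enorm_le _ _).trans le_add_self)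
  have hg2 : ∀ (y : E3), ‖u y j‖ₑ ≤ (1 + ‖u y‖ₑ) ^ 2 := by
    intro y
    rw [sq]
    calc ‖u y j‖ₑ ≤ 1 * (1 + ‖u y‖ₑ) := by
          rw [one_mul]; exact (coord_enorm_le _ _).trans le_add_self
      _ ≤ _ := mul_le_mul' le_self_add le_rfl
  have hlap : ∀ (i : Fin 3) (z : E3), pd i (lap3 (Hd δ)) z
      = ∑ k : Fin 3, pd i (pd k (pd k (Hd δ))) z := by
    intro i z
    unfold lap3
    rw [pd_sum _ fun k => ((Hd_smo δ).pd k).pd k]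
  have hT : ∀ (i l : Fin 3), ‖∫ y, u y i * u y l *
      (pd i (pd l (pd j (Hd δ))) (y - x) - if l = j then pd i (lap3 (Hd δ)) (y - x) else 0)‖ₑ
      ≤ ENNReal.ofReal (8 * C) * Jp (fun y => 1 + ‖u y‖ₑ) x := by
    intro i l
    refine kern_bound (K := fun z => pd i (pd l (pd j (Hd δ))) z -
      if l = j then pd i (lap3 (Hd δ)) z else 0) (by positivity) ?_ ?_ (hg1 i l) x
    · intro z
      have a1 := Hd_third hC h0 i l j z
      have a2 : ‖z‖ ^ 2 * |if l = j then pd i (lap3 (Hd δ)) z else 0| ≤ 6 * C := by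
        by_cases h : l = j
        · simp only [h, if_true, hlap]
          calc _ ≤ ‖z‖ ^ 2 * ∑ k : Fin 3, |pd i (pd k (pd k (Hd δ))) z| := by
                gcongr; exact Finset.abs_sum_le_sum_abs _ _
            _ = ∑ k : Fin 3, ‖z‖ ^ 2 * |pd i (pd k (pd k (Hd δ))) z| := Finset.mul_sum _ _ _
            _ ≤ ∑ k : Fin 3, 2 * C := Finset.sum_le_sum fun k _ => Hd_third hC h0 i k k z
            _ = 6 * C := by simp; ring
        · simp only [h, if_false]; simp; positivity
      have a3 := abs_sub (pd i (pd l (pd j (Hd δ))) z) (if l = j then pd i (lap3 (Hd δ)) z else 0)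
      have := mul_le_mul_of_nonneg_left a3 (sq_nonneg ‖z‖)
      linarith
    · intro z hz
      simp only [hlap, Hd_third_zero h0 h1 _ _ _ hz]
      simp
  have hm : ‖∫ y, u y j * lap3 (lap3 Sk) (y - x)‖ₑ
      ≤ ENNReal.ofReal M * Jp (fun y => 1 + ‖u y‖ₑ) x := by
    refine kern_bound hM0 ?_ (fun z hz => Sk_bilap_zero hz) hg2 x
    intro z
    by_cases hz : ‖z‖ ≤ 1
    · have h2 : ‖z‖ ^ 2 ≤ 1 := by nlinarith [norm_nonneg z]
      nlinarith [hM z, abs_nonneg (lap3 (lap3 Sk) z)]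
    · rw [Sk_bilap_zero (not_le.1 hz)]; simp; positivity
  refine (enorm_add_le _ _).trans ?_
  rw [add_mul]
  refine add_le_add ?_ hm
  refine (enorm_sum_le _ _).trans ?_
  calc _ ≤ ∑ i : Fin 3, ∑ l : Fin 3, ENNReal.ofReal (8 * C) * Jp (fun y => 1 + ‖u y‖ₑ) x :=
        Finset.sum_le_sum fun i _ => (enorm_sum_le _ _).trans (Finset.sum_le_sum fun l _ => hT i l)
    _ = _ := by simp; ring

lemma delta_lim {f : E3 → ℝ} (hf : LocallyIntegrable f) : ∀ᵐ x,
    Tendsto (fun n : ℕ => ∫ y, f y * (((1 / ((n:ℝ) + 1))⁻¹) ^ 3 *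
      lap3 (lap3 Sk) ((1 / ((n:ℝ) + 1))⁻¹ • (y - x)))) atTop
      (𝓝 ((∫ z, lap3 (lap3 Sk) z) * f x)) := by
  obtain ⟨M, hM0, hM⟩ := ker_bdd
  have hcs0 : HasCompactSupport (lap3 (lap3 Sk)) :=
    HasCompactSupport.intro (isCompact_closedBall (0:E3) 1) fun z hz => Sk_bilap_zero (by
      simpa using hz)
  filter_upwards [IsUnifLocDoublingMeasure.ae_tendsto_average_norm_sub volume hf 1] with x hx
  have hδ : Tendsto (fun n : ℕ => 1 / ((n:ℝ) + 1)) atTop (𝓝[>] 0) := by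
    refine tendsto_nhdsWithin_iff.2 ⟨tendsto_one_div_add_atTop_nhds_zero_nat, ?_⟩
    filter_upwards with n
    simp only [Set.mem_Ioi]; positivity
  have h1 := hx (fun _ : ℕ => x) (fun n : ℕ => 1 / ((n:ℝ) + 1)) hδ (by
    filter_upwards with n
    simp only [one_mul, mem_closedBall, dist_self]; positivity)
  rw [tendsto_iff_norm_sub_tendsto_zero]
  have h2 := h1.const_mul (M * volume.real (ball (0:E3) 1))
  rw [mul_zero] at h2
  refine squeeze_zero (fun _ => norm_nonneg _) (fun n => ?_) h2
  set δ : ℝ := 1 / ((n:ℝ) + 1) with hδd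
  have hδ0 : 0 < δ := by positivity
  have hcontδ : Continuous (fun y : E3 => δ⁻¹ ^ 3 * lap3 (lap3 Sk) (δ⁻¹ • (y - x))) :=
    continuous_const.mul (Sk_smo.lap.lap.continuous.comp
      (by fun_prop : Continuous fun y : E3 => δ⁻¹ • (y - x)))
  have hcsδ : HasCompactSupport (fun y : E3 => δ⁻¹ ^ 3 * lap3 (lap3 Sk) (δ⁻¹ • (y - x))) := by
    refine HasCompactSupport.mul_left ?_
    exact cs_comp_sub (g := fun z => lap3 (lap3 Sk) (δ⁻¹ • z))
      (hcs0.comp_smul (inv_ne_zero hδ0.ne')) x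
  have hmass : ∫ y, δ⁻¹ ^ 3 * lap3 (lap3 Sk) (δ⁻¹ • (y - x)) = ∫ z, lap3 (lap3 Sk) z := by
    rw [integral_sub_right_eq_self (fun z => δ⁻¹ ^ 3 * lap3 (lap3 Sk) (δ⁻¹ • z)) x,
      integral_const_mul, Measure.integral_comp_smul]
    simp only [finrank_euclideanSpace, Fintype.card_fin, smul_eq_mul]
    rw [abs_of_nonneg (by positivity), ← mul_assoc, mul_inv_cancel₀ (by positivity), one_mul]
  have e1 : (∫ y, f y * (δ⁻¹ ^ 3 * lap3 (lap3 Sk) (δ⁻¹ • (y - x))))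
      - (∫ z, lap3 (lap3 Sk) z) * f x
      = ∫ y, (f y - f x) * (δ⁻¹ ^ 3 * lap3 (lap3 Sk) (δ⁻¹ • (y - x))) := by
    rw [← hmass, mul_comm _ (f x), ← integral_const_mul, ← integral_sub]
    · congr 1; ext y; ring
    · exact int_mul_cs hf hcontδ hcsδ
    · exact (int_of_cs hcontδ hcsδ).const_mul _
  rw [e1]
  have hzero : ∀ y, y ∉ closedBall x δ → lap3 (lap3 Sk) (δ⁻¹ • (y - x)) = 0 := by
    intro y hy
    apply Sk_bilap_zero
    rw [mem_closedBall, dist_eq_norm, not_le] at hy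
    rw [norm_smul, Real.norm_of_nonneg (by positivity), ← div_eq_inv_mul, one_lt_div hδ0]
    exact hy
  have e2 : ∫ y, (f y - f x) * (δ⁻¹ ^ 3 * lap3 (lap3 Sk) (δ⁻¹ • (y - x)))
      = ∫ y in closedBall x δ, (f y - f x) * (δ⁻¹ ^ 3 * lap3 (lap3 Sk) (δ⁻¹ • (y - x))) := by
    refine (setIntegral_eq_integral_of_forall_compl_eq_zero fun y hy => ?_).symm
    rw [hzero y hy]; simp
  have hInt : IntegrableOn (fun y => ‖f y - f x‖) (closedBall x δ) :=
    ((hf.integrableOn_isCompact (isCompact_closedBall x δ)).sub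
      (integrableOn_const (isCompact_closedBall x δ).measure_lt_top.ne)).norm
  have e3 : ‖∫ y in closedBall x δ, (f y - f x) * (δ⁻¹ ^ 3 * lap3 (lap3 Sk) (δ⁻¹ • (y - x)))‖
      ≤ ∫ y in closedBall x δ, (δ⁻¹ ^ 3 * M) * ‖f y - f x‖ := by
    refine norm_integral_le_of_norm_le (hInt.const_mul _) ?_
    filter_upwards with y
    rw [norm_mul, norm_mul, Real.norm_of_nonneg (by positivity : 0 ≤ δ⁻¹ ^ 3), mul_comm]
    gcongr
    exact hM _
  rw [e2]
  refine e3.trans (le_of_eq ?_)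
  rw [integral_const_mul, setAverage_eq, smul_eq_mul]
  have hv : volume.real (closedBall x δ) = δ ^ 3 * volume.real (ball (0:E3) 1) := by
    rw [Measure.addHaar_real_closedBall _ _ hδ0.le]
    simp
  have : 0 < volume.real (ball (0:E3) 1) := by
    rw [measureReal_def]
    exact ENNReal.toReal_pos (measure_ball_pos _ _ one_pos).ne' measure_ball_lt_top.ne
  rw [hv]
  field_simp

lemma pointwise {u : E3 → E3} {P : E3 → ℝ} (hw : IsWeakSolutionNS u P)
    (hu1 : ∀ j, LocallyIntegrable (fun x => u x j)) :
    ∃ C : ℝ≥0∞, C ≠ ∞ ∧ ∀ᵐ x, 1 + ‖u x‖ₑ ≤ C * Jp (fun y => 1 + ‖u y‖ₑ) x := by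
  obtain ⟨C, hC, hb⟩ := delta_bound hw hu1
  set m := ‖∫ z, lap3 (lap3 Sk) z‖ₑ with hm
  have hm0 : m ≠ 0 := by rw [hm]; simpa using Sk_mass
  have hmt : m ≠ ∞ := by rw [hm]; exact enorm_ne_top
  set V := volume (closedBall (0:E3) 1) with hV
  have hV0 : V ≠ 0 := (measure_closedBall_pos _ _ one_pos).ne'
  have hVt : V ≠ ∞ := (isCompact_closedBall (0:E3) 1).measure_lt_top.ne
  refine ⟨V⁻¹ + 3 * (m⁻¹ * C), ?_, ?_⟩
  · exact ENNReal.add_ne_top.2 ⟨ENNReal.inv_ne_top.2 hV0,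
      ENNReal.mul_ne_top (by norm_num) (ENNReal.mul_ne_top (ENNReal.inv_ne_top.2 hm0) hC)⟩
  filter_upwards [delta_lim (hu1 0), delta_lim (hu1 1), delta_lim (hu1 2)] with x l0 l1 l2
  have hl : ∀ j : Fin 3, Tendsto (fun n : ℕ => ∫ y, u y j * (((1 / ((n:ℝ) + 1))⁻¹) ^ 3 *
      lap3 (lap3 Sk) ((1 / ((n:ℝ) + 1))⁻¹ • (y - x)))) atTop
      (𝓝 ((∫ z, lap3 (lap3 Sk) z) * u x j)) := by
    intro j; fin_cases j
    exacts [l0, l1, l2]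
  set J := Jp (fun y => 1 + ‖u y‖ₑ) x with hJ
  have hj : ∀ j : Fin 3, ‖u x j‖ₑ ≤ m⁻¹ * C * J := by
    intro j
    have h1 : m * ‖u x j‖ₑ ≤ C * J := by
      rw [hm, ← enorm_mul]
      refine le_of_tendsto' ((continuous_enorm.tendsto _).comp (hl j)) fun n => ?_
      refine hb j x _ (by positivity) ?_
      rw [div_le_one (by positivity)]; linarith [(Nat.cast_nonneg n : (0:ℝ) ≤ n)]
    calc ‖u x j‖ₑ = m⁻¹ * (m * ‖u x j‖ₑ) := by
          rw [← mul_assoc, ENNReal.inv_mul_cancel hm0 hmt, one_mul]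
      _ ≤ m⁻¹ * (C * J) := by gcongr
      _ = _ := by ring
  have h1J : 1 ≤ V⁻¹ * J := by
    have : V ≤ J := by
      have : V = ∫⁻ y in closedBall x 1, 1 := by
        rw [setLIntegral_const, one_mul, hV, Measure.addHaar_closedBall_center volume x]
      rw [this, hJ, Jp]
      refine setLIntegral_mono' measurableSet_closedBall fun y hy => ?_
      have a1 : ‖y - x‖ₑ ≤ 1 := by
        rw [← ofReal_norm, ← ENNReal.ofReal_one]
        rw [mem_closedBall, dist_eq_norm] at hy
        exact ENNReal.ofReal_le_ofReal hy
      have a2 : 1 ≤ (‖y - x‖ₑ ^ 2)⁻¹ := ENNReal.one_le_inv.2 (pow_le_one' a1 2)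
      have a3 : (1:ℝ≥0∞) ≤ (1 + ‖u y‖ₑ) ^ 2 := one_le_pow₀ le_self_add
      exact one_le_mul a2 a3
    calc 1 = V⁻¹ * V := (ENNReal.inv_mul_cancel hV0 hVt).symm
      _ ≤ _ := by gcongr
  have hsum : ‖u x‖ₑ ≤ ∑ j : Fin 3, ‖u x j‖ₑ := by
    have : ‖u x‖ ≤ ∑ j : Fin 3, ‖u x j‖ := by
      rw [EuclideanSpace.norm_eq]
      refine Real.sqrt_le_iff.2 ⟨by positivity, ?_⟩
      simp only [Fin.sum_univ_three]
      nlinarith [norm_nonneg (u x 0), norm_nonneg (u x 1), norm_nonneg (u x 2),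
        mul_nonneg (norm_nonneg (u x 0)) (norm_nonneg (u x 1)),
        mul_nonneg (norm_nonneg (u x 0)) (norm_nonneg (u x 2)),
        mul_nonneg (norm_nonneg (u x 1)) (norm_nonneg (u x 2))]
    have h2 := ENNReal.ofReal_le_ofReal this
    rw [ENNReal.ofReal_sum_of_nonneg (fun _ _ => norm_nonneg _)] at h2
    simpa only [ofReal_norm] using h2
  calc 1 + ‖u x‖ₑ ≤ V⁻¹ * J + ∑ j : Fin 3, m⁻¹ * C * J :=
        add_le_add h1J (hsum.trans (Finset.sum_le_sum fun j _ => hj j))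
    _ = _ := by simp; ring

/-- truncated kernel -/
def Kk (z : E3) : ℝ≥0∞ := (closedBall (0:E3) 1).indicator (fun z => (‖z‖ₑ ^ 2)⁻¹) z

lemma Kk_meas : Measurable Kk :=
  Measurable.indicator (by fun_prop) measurableSet_closedBall

lemma Jp_eq (g : E3 → ℝ≥0∞) (x : E3) : Jp g x = ∫⁻ y, Kk (y - x) * (g y) ^ 2 := by
  unfold Jp
  rw [← lintegral_indicator measurableSet_closedBall]
  congr 1; ext y
  by_cases h : y ∈ closedBall x 1
  · have h' : y - x ∈ closedBall (0:E3) 1 := by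
      rw [mem_closedBall, dist_eq_norm] at h; simpa using h
    rw [Set.indicator_of_mem h, Kk, Set.indicator_of_mem h']
  · have h' : y - x ∉ closedBall (0:E3) 1 := by
      rw [mem_closedBall, dist_eq_norm] at h; simpa using h
    rw [Set.indicator_of_notMem h, Kk, Set.indicator_of_notMem h', zero_mul]

lemma Kk_int {s : ℝ} (hs0 : 0 < s) (hs : 2 * s < 3) : ∫⁻ z, Kk z ^ s ≠ ∞ := by
  have hI : IntegrableOn (fun z : E3 => ‖z‖ ^ (-(2 * s))) (ball 0 2) := by
    refine integrableOn_ball_of_norm_le_rpow (C := 1) (α := 2 * s) (by simp) (by simpa using hs)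
      ?_ ?_
    · refine ae_of_all _ fun x => ?_
      rw [Real.norm_of_nonneg (by positivity)]; simp
    · exact (by fun_prop : Measurable fun z : E3 => ‖z‖ ^ (-(2*s))).aestronglyMeasurable
  have h2 := hI.2
  refine ne_top_of_le_ne_top h2.ne ?_
  rw [← lintegral_indicator measurableSet_ball]
  refine lintegral_mono_ae ?_
  have h0 : ∀ᵐ z : E3, z ≠ 0 := by
    simp [ae_iff]
  filter_upwards [h0] with z hz
  by_cases h : z ∈ closedBall (0:E3) 1
  · have h' : z ∈ ball (0:E3) 2 := closedBall_subset_ball (by norm_num) h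
    rw [Kk, Set.indicator_of_mem h, Set.indicator_of_mem h']
    have hzp : 0 < ‖z‖ := norm_pos_iff.2 hz
    rw [← ofReal_norm, ← ofReal_norm, Real.norm_of_nonneg (by positivity),
      ← ENNReal.ofReal_pow hzp.le, ← ENNReal.ofReal_inv_of_pos (by positivity),
      ENNReal.ofReal_rpow_of_pos (by positivity)]
    apply ENNReal.ofReal_le_ofReal
    rw [Real.rpow_neg hzp.le, Real.inv_rpow (by positivity), Real.rpow_mul hzp.le]
    norm_num
  · rw [Kk, Set.indicator_of_notMem h, ENNReal.zero_rpow_of_pos hs0]; simp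

/-- local integrability with exponent `1/a` -/
def Lqa (g : E3 → ℝ≥0∞) (a : ℝ) : Prop := ∀ R : ℝ, ∫⁻ y in ball 0 R, g y ^ (1 / a) ≠ ∞

lemma Lqa_mono {g : E3 → ℝ≥0∞} (h1 : ∀ x, 1 ≤ g x) {a b : ℝ} (ha : 0 < a) (hab : a ≤ b)
    (h : Lqa g a) : Lqa g b := by
  intro R
  refine ne_top_of_le_ne_top (h R) (lintegral_mono fun y => ?_)
  exact ENNReal.rpow_le_rpow_of_exponent_le (h1 y) (one_div_le_one_div_of_le ha hab)

lemma Jp_hoelder {g : E3 → ℝ≥0∞} (hg : Measurable g) {a c : ℝ} (ha0 : 0 < a) (ha : 2 * a ≤ 1)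
    (hc : 0 < c) (hc1 : c < 1) (hac : c ≤ 2 * a) {R : ℝ} {x : E3} (hx : x ∈ ball (0:E3) R) :
    Jp g x ≤ (∫⁻ y, Kk (y - x) ^ (1 / (1 - c)) * (ball 0 (R + 2)).indicator
        (fun y => g y ^ (1 / a)) y) ^ (2 * a - c) *
      (∫⁻ z, Kk z ^ (1 / (1 - c))) ^ (1 - 2 * a) *
      (∫⁻ y in ball 0 (R + 2), g y ^ (1 / a)) ^ c := by
  set s := 1 / (1 - c) with hs
  have hs0 : 0 < s := by rw [hs]; apply one_div_pos.2; linarith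
  set h := (ball 0 (R + 2)).indicator (fun y => g y ^ (1 / a)) with hh
  have hhm : Measurable h := Measurable.indicator (by fun_prop) measurableSet_ball
  have hKm : Measurable fun y => Kk (y - x) := Kk_meas.comp (by fun_prop)
  have hle : Jp g x ≤ ∫⁻ y, ∏ i : Fin 3,
      (![fun y => Kk (y - x) ^ s * h y, fun y => Kk (y - x) ^ s, h] i y) ^
        (![2 * a - c, 1 - 2 * a, c] i : ℝ) := by
    rw [Jp_eq]
    refine lintegral_mono fun y => ?_
    simp only [Fin.prod_univ_three, Matrix.cons_val]
    by_cases hy : y - x ∈ closedBall (0:E3) 1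
    · have hyb : y ∈ ball (0:E3) (R + 2) := by
        simp only [mem_closedBall, dist_zero_right, mem_ball] at *
        have : ‖y‖ ≤ ‖y - x‖ + ‖x‖ := by simpa using norm_add_le (y - x) x
        linarith
      rw [ENNReal.mul_rpow_of_nonneg _ _ (by linarith)]
      have e1 : h y ^ (2 * a - c) * h y ^ c = g y ^ 2 := by
        rw [← ENNReal.rpow_add_of_nonneg _ _ (by linarith) hc.le, hh, Set.indicator_of_mem hyb,
          ← ENNReal.rpow_mul, ← ENNReal.rpow_natCast]
        congr 1; field_simp; push_cast; ring
      have e2 : (Kk (y - x) ^ s) ^ (2 * a - c) * (Kk (y - x) ^ s) ^ (1 - 2 * a) = Kk (y - x) := by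
        rw [← ENNReal.rpow_add_of_nonneg _ _ (by linarith) (by linarith), ← ENNReal.rpow_mul]
        have : s * (2 * a - c + (1 - 2 * a)) = 1 := by
          rw [hs]; have : 1 - c ≠ 0 := by linarith
          field_simp; ring
        rw [this, ENNReal.rpow_one]
      rw [← e1]
      nth_rewrite 1 [← e2]
      apply le_of_eq; ring
    · have : Kk (y - x) = 0 := by rw [Kk, Set.indicator_of_notMem hy]
      rw [this, zero_mul]; exact zero_le
  refine hle.trans ((ENNReal.lintegral_prod_norm_pow_le Finset.univ ?_ ?_ ?_).trans ?_)
  · intro i _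
    fin_cases i
    · exact ((hKm.pow_const s).mul hhm).aemeasurable
    · exact (hKm.pow_const s).aemeasurable
    · exact hhm.aemeasurable
  · simp [Fin.sum_univ_three]
  · intro i _
    fin_cases i <;> simp <;> linarith
  · simp only [Fin.prod_univ_three, Matrix.cons_val]
    rw [lintegral_sub_right_eq_self (fun z => Kk z ^ s) x, hh,
      lintegral_indicator measurableSet_ball]

lemma boot_final {g : E3 → ℝ≥0∞} (hg : Measurable g) (h1 : ∀ x, 1 ≤ g x) {C : ℝ≥0∞} (hC : C ≠ ∞)
    (hJ : ∀ᵐ x, g x ≤ C * Jp g x) {a c : ℝ} (ha0 : 0 < a)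
    (hc : 0 < c) (hc1 : c < 1 / 3) (hac : a ≤ c / 2) (h : Lqa g a) :
    ∀ R : ℝ, ∃ M : ℝ≥0∞, M ≠ ∞ ∧ ∀ᵐ x, x ∈ ball (0:E3) R → g x ≤ M := by
  intro R
  have h' := Lqa_mono h1 ha0 hac h
  have hs0 : 0 < 1 / (1 - c) := by apply one_div_pos.2; linarith
  have hs1 : 2 * (1 / (1 - c)) < 3 := by
    rw [mul_one_div, div_lt_iff₀ (by linarith)]; linarith
  refine ⟨C * ((∫⁻ z, Kk z ^ (1 / (1 - c))) ^ (1 - 2 * (c / 2)) *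
      (∫⁻ y in ball 0 (R + 2), g y ^ (1 / (c / 2))) ^ c), ?_, ?_⟩
  · refine ENNReal.mul_ne_top hC (ENNReal.mul_ne_top ?_ ?_)
    · exact ENNReal.rpow_ne_top_of_nonneg (by linarith) (Kk_int hs0 hs1)
    · exact ENNReal.rpow_ne_top_of_nonneg hc.le (h' _)
  · filter_upwards [hJ] with x hx hxR
    refine hx.trans ?_
    gcongr
    refine (Jp_hoelder hg (a := c / 2) (by linarith) (by linarith) hc (by linarith) (by linarith) hxR).trans ?_
    rw [show 2 * (c / 2) - c = 0 by ring, ENNReal.rpow_zero, one_mul]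

lemma boot_step {g : E3 → ℝ≥0∞} (hg : Measurable g) {C : ℝ≥0∞} (hC : C ≠ ∞)
    (hJ : ∀ᵐ x, g x ≤ C * Jp g x) {a c : ℝ} (ha0 : 0 < a)
    (hc : 0 < c) (hc1 : c < 1 / 3) (hac : a < c) (hac2 : c / 2 < a) (h : Lqa g a) :
    Lqa g (2 * a - c) := by
  intro R
  have hs0 : 0 < 1 / (1 - c) := by apply one_div_pos.2; linarith
  have hs1 : 2 * (1 / (1 - c)) < 3 := by
    rw [mul_one_div, div_lt_iff₀ (by linarith)]; linarith
  set s := 1 / (1 - c) with hs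
  set hh := (ball 0 (R + 2)).indicator (fun y => g y ^ (1 / a)) with hhd
  have hhm : Measurable hh := Measurable.indicator (by fun_prop) measurableSet_ball
  set A := C * ((∫⁻ z, Kk z ^ s) ^ (1 - 2 * a) *
      (∫⁻ y in ball 0 (R + 2), g y ^ (1 / a)) ^ c) with hA
  have hAt : A ≠ ∞ := by
    refine ENNReal.mul_ne_top hC (ENNReal.mul_ne_top ?_ ?_)
    · exact ENNReal.rpow_ne_top_of_nonneg (by linarith) (Kk_int hs0 hs1)
    · exact ENNReal.rpow_ne_top_of_nonneg hc.le (h _)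
  have hr : 0 < 2 * a - c := by linarith
  have hpt : ∀ᵐ x ∂(volume.restrict (ball (0:E3) R)), g x ^ (1 / (2 * a - c)) ≤
      A ^ (1 / (2 * a - c)) * ∫⁻ y, Kk (y - x) ^ s * hh y := by
    rw [ae_restrict_iff' measurableSet_ball]
    filter_upwards [hJ] with x hx hxR
    have h2 : g x ≤ A * (∫⁻ y, Kk (y - x) ^ s * hh y) ^ (2 * a - c) := by
      refine hx.trans ?_
      rw [hA, mul_assoc]
      gcongr
      refine (Jp_hoelder hg ha0 (by linarith) hc (by linarith) (by linarith) hxR).trans ?_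
      rw [mul_assoc, mul_comm]
    refine (ENNReal.rpow_le_rpow h2 (by positivity)).trans ?_
    rw [ENNReal.mul_rpow_of_nonneg _ _ (by positivity), ← ENNReal.rpow_mul,
      mul_one_div_cancel hr.ne', ENNReal.rpow_one]
  refine ne_top_of_le_ne_top ?_ (lintegral_mono_ae hpt)
  rw [lintegral_const_mul' _ _ (ENNReal.rpow_ne_top_of_nonneg (by positivity) hAt)]
  refine ENNReal.mul_ne_top (ENNReal.rpow_ne_top_of_nonneg (by positivity) hAt) ?_
  refine ne_top_of_le_ne_top ?_ (setLIntegral_le_lintegral _ _)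
  rw [lintegral_lintegral_swap]
  · have : ∀ y : E3, ∫⁻ x, Kk (y - x) ^ s * hh y = (∫⁻ z, Kk z ^ s) * hh y := by
      intro y
      rw [lintegral_mul_const _ (by exact (Kk_meas.comp (by fun_prop)).pow_const s),
        lintegral_sub_left_eq_self (fun z => Kk z ^ s) y]
    simp only [this]
    rw [lintegral_const_mul _ hhm, hhd, lintegral_indicator measurableSet_ball]
    exact ENNReal.mul_ne_top (Kk_int hs0 hs1) (h _)
  · apply Measurable.aemeasurable
    exact ((Kk_meas.comp (by fun_prop)).pow_const s).mul (hhm.comp measurable_snd)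

lemma boot {g : E3 → ℝ≥0∞} (hg : Measurable g) (h1 : ∀ x, 1 ≤ g x) {C : ℝ≥0∞} (hC : C ≠ ∞)
    (hJ : ∀ᵐ x, g x ≤ C * Jp g x) {q : ℝ} (hq : 3 < q)
    (h : ∀ R : ℝ, ∫⁻ y in ball 0 R, g y ^ q ≠ ∞) :
    ∀ R : ℝ, ∃ M : ℝ≥0∞, M ≠ ∞ ∧ ∀ᵐ x, x ∈ ball (0:E3) R → g x ≤ M := by
  have h0 : Lqa g (1 / q) := by
    intro R; rw [one_div_one_div]; exact h R
  have hq' : 1 / q < 1 / 3 := one_div_lt_one_div_of_lt (by norm_num) hq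
  obtain ⟨c, hc1, hc2⟩ := exists_between hq'
  have hq0 : 0 < 1 / q := by positivity
  have hc : 0 < c := hq0.trans hc1
  have key : ∀ n : ℕ, ∀ a : ℝ, 0 < a → a < c → c / 2 < 2 ^ n * (c - a) → Lqa g a →
      ∀ R : ℝ, ∃ M : ℝ≥0∞, M ≠ ∞ ∧ ∀ᵐ x, x ∈ ball (0:E3) R → g x ≤ M := by
    intro n
    induction n with
    | zero =>
      intro a ha hac h2 hL
      exact boot_final hg h1 hC hJ ha hc hc2 (by norm_num at h2; linarith) hL
    | succ n ih =>
      intro a ha hac h2 hL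
      by_cases h3 : a ≤ c / 2
      · exact boot_final hg h1 hC hJ ha hc hc2 h3 hL
      · push Not at h3
        refine ih (2 * a - c) (by linarith) (by linarith) ?_
          (boot_step hg hC hJ ha hc hc2 hac h3 hL)
        rw [pow_succ] at h2; linarith
  obtain ⟨n, hn⟩ := pow_unbounded_of_one_lt (c / 2 / (c - 1 / q)) (by norm_num : (1:ℝ) < 2)
  refine key n (1 / q) hq0 hc1 ?_ h0
  rwa [div_lt_iff₀ (by linarith)] at hn

/-- mollification -/
def mol (η : E3 → ℝ) (f : E3 → ℝ) (x : E3) : ℝ := ∫ y, f y * η (x - y)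

lemma mol_eq_conv (η f : E3 → ℝ) :
    mol η f = convolution f η (ContinuousLinearMap.mul ℝ ℝ) volume := by
  ext x; simp [mol, convolution]

lemma mol_smo {η f : E3 → ℝ} (hf : LocallyIntegrable f) (hη : Smo η) (hc : HasCompactSupport η) :
    Smo (mol η f) := by
  rw [mol_eq_conv]
  exact hc.contDiff_convolution_right _ hf hη

lemma mol_pd {η f : E3 → ℝ} (hf : LocallyIntegrable f) (hη : Smo η) (hc : HasCompactSupport η)
    (i : Fin 3) : pd i (mol η f) = mol (pd i η) f := by
  ext x
  have h := hc.hasFDerivAt_convolution_right (ContinuousLinearMap.mul ℝ ℝ) hf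
    (hη.of_le (by exact_mod_cast le_top)) x
  rw [← mol_eq_conv] at h
  unfold pd
  rw [h.fderiv]
  unfold convolution mol
  rw [ContinuousLinearMap.integral_apply]
  · rfl
  · have hcont : Continuous (fun y => fderiv ℝ η (x - y)) :=
      (hη.continuous_fderiv (by simp)).comp (by fun_prop)
    have hcs : HasCompactSupport (fun y => fderiv ℝ η (x - y)) :=
      (hc.fderiv (𝕜 := ℝ)).comp_homeomorph (Homeomorph.subLeft x)
    exact hf.integrable_smul_right_of_hasCompactSupport hcont hcs

lemma mol_lap {η f : E3 → ℝ} (hf : LocallyIntegrable f) (hη : Smo η) (hc : HasCompactSupport η) :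
    lap3 (mol η f) = mol (lap3 η) f := by
  ext x
  simp only [lap3]
  simp only [mol_pd hf hη hc, mol_pd hf (hη.pd _) (cs_pd hc _), mol]
  rw [← integral_finsetSum]
  · congr 1; ext y; exact (Finset.mul_sum _ _ _).symm
  · intro i _
    exact int_mul_cs hf (((hη.pd i).pd i).comp_rsub x).continuous
      (cs_comp_rsub (cs_pd (cs_pd hc i) i) x)

lemma lap_comp_rsub {g : E3 → ℝ} (hg : Smo g) (a : E3) :
    lap3 (fun y => g (a - y)) = fun y => lap3 g (a - y) := by
  ext y
  simp only [lap3, pd_comp_rsub hg]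
  refine Finset.sum_congr rfl fun i _ => ?_
  have : (fun y => - pd i g (a - y)) = fun y => (-1) * pd i g (a - y) := by ext; ring
  rw [this, pd_const_mul ((hg.pd i).comp_rsub a), pd_comp_rsub (hg.pd i)]; ring

/-- weak equation tested with a scalar function in one component -/
lemma weak_comp {u : E3 → E3} {P : E3 → ℝ} (hw : IsWeakSolutionNS u P)
    {ψ : E3 → ℝ} (hψ : Smo ψ) (hc : HasCompactSupport ψ) (j : Fin 3) :
    (∫ x, u x j * lap3 ψ x) + (∑ i : Fin 3, ∫ x, u x i * u x j * pd i ψ x) +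
      ∫ x, P x * pd j ψ x = 0 := by
  set φ : E3 → E3 := fun y => ψ y • EuclideanSpace.single j (1:ℝ) with hφ
  have h1 := hw.1 φ (hψ.smul contDiff_const) (hc.smul_right)
  have e0 : ∀ l : Fin 3, (fun y => φ y l) = if l = j then ψ else fun _ => 0 := by
    intro l; ext y; by_cases h : l = j <;> simp [hφ, h]
  have e1 : ∀ i l : Fin 3, pd i (fun y => φ y l) = if l = j then pd i ψ else fun _ => 0 := by
    intro i l; rw [e0]; by_cases h : l = j <;> simp [h, pd_zero]
  have e2 : ∀ l : Fin 3, lap3 (fun y => φ y l) = if l = j then lap3 ψ else fun _ => 0 := by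
    intro l; ext y; unfold lap3; simp only [e1]; by_cases h : l = j <;> simp [h, pd_zero]
  simp only [e1, e2] at h1
  have f1 : ∀ x, ∑ l, u x l * (if l = j then lap3 ψ else fun _ => 0) x = u x j * lap3 ψ x := by
    intro x
    rw [Finset.sum_eq_single j] <;> simp +contextual
  have f3 : ∀ x, ∑ l, (if l = j then pd l ψ else fun _ => 0) x = pd j ψ x := by
    intro x
    rw [Finset.sum_eq_single j] <;> simp +contextual
  have f2 : ∀ i, ∑ l, ∫ x, u x i * u x l * (if l = j then pd i ψ else fun _ => 0) x
      = ∫ x, u x i * u x j * pd i ψ x := by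
    intro i
    rw [Finset.sum_eq_single j] <;> simp +contextual
  simp only [f1, f2, f3] at h1
  exact h1

lemma mol_eqn {u : E3 → E3} {P : E3 → ℝ} (hw : IsWeakSolutionNS u P)
    (hu1 : ∀ j, LocallyIntegrable (fun x => u x j))
    (hu2 : ∀ i j, LocallyIntegrable (fun x => u x i * u x j))
    (hP : LocallyIntegrable P)
    {η : E3 → ℝ} (hη : Smo η) (hc : HasCompactSupport η) (j : Fin 3) (x : E3) :
    lap3 (mol η (fun x => u x j)) x = ∑ i, pd i (mol η (fun x => u x i * u x j)) x
      + pd j (mol η P) x := by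
  have h := weak_comp hw (hη.comp_rsub x) (cs_comp_rsub hc x) j
  simp only [lap_comp_rsub hη, pd_comp_rsub hη] at h
  rw [mol_lap (hu1 j) hη hc, mol_pd hP hη hc]
  simp only [mol_pd (hu2 _ _) hη hc]
  simp only [mul_neg, integral_neg, Finset.sum_neg_distrib] at h
  simp only [mol]
  linarith

lemma mol_div {u : E3 → E3} {P : E3 → ℝ} (hw : IsWeakSolutionNS u P)
    (hu1 : ∀ j, LocallyIntegrable (fun x => u x j))
    {η : E3 → ℝ} (hη : Smo η) (hc : HasCompactSupport η) (x : E3) :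
    ∑ i, pd i (mol η (fun x => u x i)) x = 0 := by
  have h := hw.2 _ (hη.comp_rsub x) (cs_comp_rsub hc x)
  simp only [pd_comp_rsub hη] at h
  rw [integral_finsetSum] at h
  · simp only [mol_pd (hu1 _) hη hc, mol]
    simp only [mul_neg, integral_neg, Finset.sum_neg_distrib] at h
    linarith
  · intro i _
    simp only [mul_neg]
    exact (int_mul_cs (hu1 i) ((hη.pd i).comp_rsub x).continuous
      (cs_comp_rsub (cs_pd hc i) x)).neg

/-- the mollifier sequence -/
def bmp (n : ℕ) : ContDiffBump (0:E3) where
  rIn := 1 / (2 * (n + 1))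
  rOut := 1 / (n + 1)
  rIn_pos := by positivity
  rIn_lt_rOut := by
    apply one_div_lt_one_div_of_lt <;> linarith [(by positivity : (0:ℝ) ≤ n)]

def eta (n : ℕ) : E3 → ℝ := (bmp n).normed volume

lemma eta_smo (n : ℕ) : Smo (eta n) := (bmp n).contDiff_normed
lemma eta_cs (n : ℕ) : HasCompactSupport (eta n) := (bmp n).hasCompactSupport_normed
lemma eta_nonneg (n : ℕ) (x : E3) : 0 ≤ eta n x := (bmp n).nonneg_normed x
lemma eta_int (n : ℕ) : ∫ x, eta n x = 1 := (bmp n).integral_normed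
lemma bmp_rOut (n : ℕ) : (bmp n).rOut = 1 / (n + 1) := rfl
lemma bmp_tend : Tendsto (fun n => (bmp n).rOut) atTop (𝓝 0) := by
  simp only [bmp_rOut]; exact tendsto_one_div_add_atTop_nhds_zero_nat
lemma bmp_le (n : ℕ) : (bmp n).rOut ≤ 1 := by
  rw [bmp_rOut, div_le_one (by positivity)]; linarith [(by positivity : (0:ℝ) ≤ n)]
lemma eta_supp {n : ℕ} {z : E3} (hz : eta n z ≠ 0) : ‖z‖ < 1 := by
  have : z ∈ Function.support ((bmp n).normed (volume : Measure E3)) := hz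
  rw [(bmp n).support_normed_eq] at this
  have h2 : ‖z‖ < (bmp n).rOut := by simpa using this
  exact h2.trans_le (bmp_le n)
lemma eta_lint (n : ℕ) (x : E3) : ∫⁻ y, ‖eta n (x - y)‖ₑ = 1 := by
  rw [lintegral_sub_left_eq_self (fun z => ‖eta n z‖ₑ) x]
  have : ∫⁻ z, ‖eta n z‖ₑ = ENNReal.ofReal (∫ z, eta n z) := by
    rw [ofReal_integral_eq_lintegral_ofReal (int_of_cs (eta_smo n).continuous (eta_cs n))
      (ae_of_all _ (eta_nonneg n))]
    congr 1; ext z; rw [← ofReal_norm, Real.norm_of_nonneg (eta_nonneg n z)]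
  rw [this, eta_int]; simp

lemma mol_ae {f : E3 → ℝ} (hf : LocallyIntegrable f) :
    ∀ᵐ x, Tendsto (fun n => mol (eta n) f x) atTop (𝓝 (f x)) := by
  have := ContDiffBump.ae_convolution_tendsto_right_of_locallyIntegrable (φ := bmp) (K := 2)
    bmp_tend (Eventually.of_forall fun n => by
      rw [bmp_rOut, bmp]; simp; field_simp; rfl) hf
  filter_upwards [this] with x hx
  refine hx.congr fun n => ?_
  rw [convolution_eq_swap, mol]
  congr 1; ext y
  simp [eta, mul_comm]

lemma mol_cont {f : E3 → ℝ} (hf : Continuous f) (n : ℕ) {x : E3} {ε : ℝ}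
    (h : ∀ y ∈ ball x (bmp n).rOut, dist (f y) (f x) ≤ ε) : |mol (eta n) f x - f x| ≤ ε := by
  have := (bmp n).dist_normed_convolution_le (μ := volume) hf.aestronglyMeasurable h
  rw [Real.dist_eq] at this
  convert this using 3
  rw [convolution_eq_swap, mol]
  congr 1; ext y
  simp [eta, mul_comm]

lemma mol_bound {f : E3 → ℝ} {R M : ℝ} (hM : ∀ᵐ y, y ∈ ball (0:E3) (R + 1) → |f y| ≤ M)
    (n : ℕ) {x : E3} (hx : x ∈ ball (0:E3) R) : |mol (eta n) f x| ≤ M := by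
  have hi : Integrable (fun y => eta n (x - y)) :=
    int_of_cs ((eta_smo n).comp_rsub x).continuous (cs_comp_rsub (eta_cs n) x)
  have h1 : ‖mol (eta n) f x‖ ≤ ∫ y, M * eta n (x - y) := by
    refine norm_integral_le_of_norm_le (hi.const_mul M) ?_
    filter_upwards [hM] with y hy
    rw [norm_mul, Real.norm_of_nonneg (eta_nonneg n _), Real.norm_eq_abs]
    by_cases h0 : eta n (x - y) = 0
    · simp [h0]
    · refine mul_le_mul_of_nonneg_right (hy ?_) (eta_nonneg n _)
      have := eta_supp h0
      simp only [mem_ball, dist_zero_right] at *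
      have h3 : ‖y‖ ≤ ‖x‖ + ‖x - y‖ := by
        simpa using norm_sub_le x (x - y)
      linarith
  rw [integral_const_mul, integral_sub_left_eq_self (fun z => eta n z), eta_int, mul_one] at h1
  simpa using h1

lemma mol_L1_le {f : E3 → ℝ} (hf : Integrable f) (n : ℕ) :
    ∫⁻ x, ‖mol (eta n) f x‖ₑ ≤ ∫⁻ y, ‖f y‖ₑ := by
  obtain ⟨g, hg, hfg⟩ := hf.1.enorm
  calc ∫⁻ x, ‖mol (eta n) f x‖ₑ ≤ ∫⁻ x, ∫⁻ y, g y * ‖eta n (x - y)‖ₑ := by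
        refine lintegral_mono fun x => ?_
        refine (enorm_integral_le_lintegral_enorm _).trans (le_of_eq ?_)
        refine lintegral_congr_ae ?_
        filter_upwards [hfg] with y hy
        rw [enorm_mul, hy]
    _ = ∫⁻ y, ∫⁻ x, g y * ‖eta n (x - y)‖ₑ := by
        rw [lintegral_lintegral_swap]
        apply Measurable.aemeasurable
        refine (hg.comp measurable_snd).mul ?_
        exact ((eta_smo n).continuous.comp (by fun_prop)).enorm.measurable
    _ = ∫⁻ y, g y := by
        congr 1; ext y
        rw [lintegral_const_mul _ (by
          exact ((eta_smo n).continuous.comp (by fun_prop)).enorm.measurable)]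
        rw [lintegral_sub_right_eq_self (fun z => ‖eta n z‖ₑ) y]
        have := eta_lint n 0
        rw [lintegral_sub_left_eq_self (fun z => ‖eta n z‖ₑ) 0] at this
        rw [this, mul_one]
    _ = _ := (lintegral_congr_ae hfg).symm

lemma mol_sub {f g : E3 → ℝ} (hf : LocallyIntegrable f) (hg : LocallyIntegrable g) (n : ℕ) (x : E3) :
    mol (eta n) (fun y => f y - g y) x = mol (eta n) f x - mol (eta n) g x := by
  have hc := ((eta_smo n).comp_rsub x).continuous
  have hs := cs_comp_rsub (eta_cs n) x
  unfold mol
  rw [← integral_sub (int_mul_cs hf hc hs) (int_mul_cs hg hc hs)]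
  congr 1; ext y; ring

lemma mol_L1 {f : E3 → ℝ} (hf : LocallyIntegrable f) (R : ℝ) :
    Tendsto (fun n => ∫⁻ x in ball 0 R, ‖mol (eta n) f x - f x‖ₑ) atTop (𝓝 0) := by
  set Q := (closedBall (0:E3) (R + 1)).indicator f with hQ
  have hQi : Integrable Q := by
    rw [hQ, integrable_indicator_iff measurableSet_closedBall]
    exact hf.integrableOn_isCompact (isCompact_closedBall _ _)
  have hmQ : ∀ n, ∀ x ∈ ball (0:E3) R, mol (eta n) f x = mol (eta n) Q x := by
    intro n x hx
    unfold mol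
    congr 1; ext y
    by_cases h0 : eta n (x - y) = 0
    · simp [h0]
    · have := eta_supp h0
      have hy : y ∈ closedBall (0:E3) (R + 1) := by
        simp only [mem_ball, dist_zero_right, mem_closedBall] at *
        have h3 : ‖y‖ ≤ ‖x‖ + ‖x - y‖ := by
          simpa using norm_sub_le x (x - y)
        linarith
      rw [hQ, Set.indicator_of_mem hy]
  have hQx : ∀ x ∈ ball (0:E3) R, f x = Q x := by
    intro x hx
    rw [hQ, Set.indicator_of_mem]
    exact ball_subset_closedBall (ball_subset_ball (by linarith) hx)
  rw [ENNReal.tendsto_atTop_zero]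
  intro ε hε
  by_cases hεt : ε = ∞
  · exact ⟨0, fun n _ => hεt ▸ le_top⟩
  have hε3 : ε / 3 ≠ 0 := by simp [hε.ne']
  obtain ⟨g, hgc, hgi, hgco, hgint⟩ := hQi.exists_hasCompactSupport_lintegral_sub_le hε3
  have hV : volume (ball (0:E3) R) ≠ ∞ := measure_ball_lt_top.ne
  obtain ⟨τ, hτ0, hτ⟩ : ∃ τ : ℝ, 0 < τ ∧ ENNReal.ofReal τ * volume (ball (0:E3) R) ≤ ε / 3 := by
    set v := volume (ball (0:E3) R)
    refine ⟨(ε / 3).toReal / (v.toReal + 1), ?_, ?_⟩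
    · exact div_pos (ENNReal.toReal_pos hε3 (ENNReal.div_ne_top hεt (by norm_num))) (by positivity)
    · rw [← ENNReal.ofReal_toReal hV, ← ENNReal.ofReal_mul (by positivity)]
      refine ENNReal.ofReal_le_of_le_toReal ?_
      rw [div_mul_eq_mul_div, ENNReal.toReal_ofReal (by positivity), div_le_iff₀ (by positivity)]
      nlinarith [ENNReal.toReal_nonneg (a := ε / 3)]
  have huc := hgc.uniformContinuous_of_continuous hgco
  rw [Metric.uniformContinuous_iff] at huc
  obtain ⟨δ, hδ, hgδ⟩ := huc τ hτ0
  obtain ⟨N, hN⟩ := (bmp_tend.eventually (gt_mem_nhds hδ)).exists_forall_of_atTop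
  refine ⟨N, fun n hn => ?_⟩
  have hb : ∀ x, |mol (eta n) g x - g x| ≤ τ := fun x =>
    mol_cont hgco n fun y hy => (hgδ ((mem_ball.1 hy).trans (hN n hn))).le
  calc ∫⁻ x in ball 0 R, ‖mol (eta n) f x - f x‖ₑ
      ≤ ∫⁻ x in ball 0 R, (‖mol (eta n) (fun y => Q y - g y) x‖ₑ + ENNReal.ofReal τ + ‖Q x - g x‖ₑ) := by
        refine setLIntegral_mono' measurableSet_ball fun x hx => ?_
        rw [hmQ n x hx, hQx x hx, mol_sub hQi.locallyIntegrable hgint.locallyIntegrable]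
        have e : mol (eta n) Q x - Q x = (mol (eta n) Q x - mol (eta n) g x) +
          (mol (eta n) g x - g x) - (Q x - g x) := by ring
        rw [e]
        refine (enorm_sub_le).trans ?_
        gcongr
        refine (enorm_add_le _ _).trans ?_
        gcongr
        rw [← ofReal_norm]
        exact ENNReal.ofReal_le_ofReal (hb x)
    _ = (∫⁻ x in ball 0 R, ‖mol (eta n) (fun y => Q y - g y) x‖ₑ) +
          ENNReal.ofReal τ * volume (ball (0:E3) R) + ∫⁻ x in ball 0 R, ‖Q x - g x‖ₑ := by
        rw [lintegral_add_right', lintegral_add_right', lintegral_const]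
        · simp
        · fun_prop
        · exact ((hQi.sub hgint).1.restrict).enorm
    _ ≤ ε / 3 + ε / 3 + ε / 3 := by
        gcongr
        · exact (setLIntegral_le_lintegral _ _).trans ((mol_L1_le (hQi.sub hgint) n).trans hgi)
        · exact (setLIntegral_le_lintegral _ _).trans hgi
    _ = ε := by rw [ENNReal.add_thirds]

/-- boundary-type terms in the local energy inequality -/
def Bt (v : Fin 3 → E3 → ℝ) (T : Fin 3 → Fin 3 → E3 → ℝ) (Q θ : E3 → ℝ) (x : E3) : ℝ :=
  ∑ i, ∑ j, (T i j x * v j x * pd i θ x - 1/2 * (v j x * v j x) * (v i x * pd i θ x)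
    + 1/2 * (v j x * v j x) * pd i (pd i θ) x) + Q x * ∑ i, v i x * pd i θ x

lemma pd_off {θ : E3 → ℝ} {x : E3} (hx : x ∉ tsupport θ) (i : Fin 3) : pd i θ x = 0 := by
  have h : fderiv ℝ θ x = 0 := by
    by_contra hne
    exact hx (support_fderiv_subset (𝕜 := ℝ) (f := θ) hne)
  simp [pd, h]

lemma tsupport_pd (θ : E3 → ℝ) (i : Fin 3) : tsupport (pd i θ) ⊆ tsupport θ := by
  refine closure_minimal (fun x hx => ?_) (isClosed_tsupport _)
  by_contra h
  exact hx (pd_off h i)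

lemma energy {v : Fin 3 → E3 → ℝ} {T : Fin 3 → Fin 3 → E3 → ℝ} {Q θ : E3 → ℝ}
    (hv : ∀ j, Smo (v j)) (hT : ∀ i j, Smo (T i j)) (hQ : Smo Q) (hθ : Smo θ)
    (hc : HasCompactSupport θ) (hθ0 : ∀ x, 0 ≤ θ x)
    (heq : ∀ j x, lap3 (v j) x = ∑ i, pd i (T i j) x + pd j Q x)
    (hdiv : ∀ x, ∑ i, pd i (v i) x = 0) :
    ∫ x, θ x * ∑ i, ∑ j, (pd i (v j) x) ^ 2 ≤
      (∫ x, θ x * ∑ i, ∑ j, (T i j x - v i x * v j x) ^ 2) + 2 * ∫ x, Bt v T Q θ x := by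
  let W : Fin 3 → Fin 3 → E3 → ℝ := fun i j x =>
    (((θ x * (v j x * pd i (v j) x) - (1/2) * ((v j x * v j x) * pd i θ x))
      - T i j x * (θ x * v j x)) + (1/2) * ((v j x * v j x) * (v i x * θ x)))
      - (1/3) * (Q x * (θ x * v i x))
  have hvv : ∀ j, Smo (fun x => v j x * v j x) := fun j => (hv j).mul (hv j)
  have s1 : ∀ i j, Smo (fun x => θ x * (v j x * pd i (v j) x)) := fun i j =>
    hθ.mul ((hv j).mul ((hv j).pd i))
  have s2 : ∀ i j, Smo (fun x => (v j x * v j x) * pd i θ x) := fun i j => (hvv j).mul (hθ.pd i)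
  have s3 : ∀ i j, Smo (fun x => T i j x * (θ x * v j x)) := fun i j =>
    (hT i j).mul (hθ.mul (hv j))
  have s4 : ∀ i j, Smo (fun x => (v j x * v j x) * (v i x * θ x)) := fun i j =>
    (hvv j).mul ((hv i).mul hθ)
  have s5 : ∀ i, Smo (fun x => Q x * (θ x * v i x)) := fun i => hQ.mul (hθ.mul (hv i))
  have c2 : ∀ i j, Smo (fun x => (1/2) * ((v j x * v j x) * pd i θ x)) := fun i j =>
    contDiff_const.mul (s2 i j)
  have c4 : ∀ i j, Smo (fun x => (1/2) * ((v j x * v j x) * (v i x * θ x))) := fun i j =>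
    contDiff_const.mul (s4 i j)
  have c5 : ∀ i, Smo (fun x => (1/3) * (Q x * (θ x * v i x))) := fun i =>
    contDiff_const.mul (s5 i)
  have hW : ∀ i j, Smo (W i j) := fun i j =>
    (((((s1 i j).sub (c2 i j)).sub (s3 i j)).add (c4 i j)).sub (c5 i))
  have hWc : ∀ i j, HasCompactSupport (W i j) := by
    intro i j
    refine HasCompactSupport.intro hc.isCompact fun x hx => ?_
    have h1 : θ x = 0 := image_eq_zero_of_notMem_tsupport hx
    have h2 : pd i θ x = 0 := pd_off hx i
    simp [W, h1, h2]
  have hexp : ∀ i j x, pd i (W i j) x =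
      θ x * (v j x * pd i (pd i (v j)) x + pd i (v j) x * pd i (v j) x)
        + pd i θ x * (v j x * pd i (v j) x)
      - (1/2) * ((v j x * v j x) * pd i (pd i θ) x + (v j x * pd i (v j) x + pd i (v j) x * v j x)
          * pd i θ x)
      - (T i j x * (θ x * pd i (v j) x + pd i θ x * v j x) + pd i (T i j) x * (θ x * v j x))
      + (1/2) * ((v j x * v j x) * (v i x * pd i θ x + pd i (v i) x * θ x)
        + (v j x * pd i (v j) x + pd i (v j) x * v j x) * (v i x * θ x))
      - (1/3) * (Q x * (θ x * pd i (v i) x + pd i θ x * v i x) + pd i Q x * (θ x * v i x)) := by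
    intro i j x
    simp only [W]
    rw [pd_sub ((((s1 i j).sub (c2 i j)).sub (s3 i j)).add (c4 i j)) (c5 i),
      pd_add (((s1 i j).sub (c2 i j)).sub (s3 i j)) (c4 i j),
      pd_sub ((s1 i j).sub (c2 i j)) (s3 i j), pd_sub (s1 i j) (c2 i j)]
    simp only []
    rw [pd_const_mul (s2 i j), pd_const_mul (s4 i j), pd_const_mul (s5 i)]
    simp only []
    rw [pd_mul hθ ((hv j).mul ((hv j).pd i)), pd_mul (hv j) ((hv j).pd i),
      pd_mul (hvv j) (hθ.pd i), pd_mul (hT i j) (hθ.mul (hv j)), pd_mul hθ (hv j),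
      pd_mul (hvv j) ((hv i).mul hθ), pd_mul (hv i) hθ, pd_mul hQ (hθ.mul (hv i)),
      pd_mul hθ (hv i), pd_mul (hv j) (hv j)]
  have hWi : ∀ i j, Integrable (pd i (W i j)) := fun i j =>
    int_of_cs ((hW i j).pd i).continuous (cs_pd (hWc i j) i)
  have hD : ∫ x, ∑ i, ∑ j, pd i (W i j) x = 0 := by
    rw [integral_finsetSum _ fun i _ => integrable_finsetSum _ fun j _ => hWi i j]
    refine Finset.sum_eq_zero fun i _ => ?_
    rw [integral_finsetSum _ fun j _ => hWi i j]
    exact Finset.sum_eq_zero fun j _ => int_pd_zero (hW i j) (hWc i j) i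
  have hDi : Integrable (fun x => ∑ i, ∑ j, pd i (W i j) x) :=
    integrable_finsetSum _ fun i _ => integrable_finsetSum _ fun j _ => hWi i j
  have hcθ : ∀ {g : E3 → ℝ}, Continuous g → Integrable (fun x => θ x * g x) := by
    intro g hg
    exact int_of_cs (hθ.continuous.mul hg) (hc.mul_right)
  have hiT : Integrable (fun x => θ x * ∑ i, ∑ j, (T i j x - v i x * v j x) ^ 2) := by
    refine hcθ ?_
    have := fun i j => (hT i j).continuous
    have := fun i => (hv i).continuous
    fun_prop
  have hiL : Integrable (fun x => θ x * ∑ i, ∑ j, (pd i (v j) x) ^ 2) := by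
    refine hcθ ?_
    have := fun i j => ((hv j).pd i).continuous
    fun_prop
  have hBpt : ∀ x, Bt v T Q θ x = θ x * ∑ i, ∑ j, (pd i (v j) x) ^ 2
      - (∑ i, ∑ j, pd i (W i j) x) - θ x * ∑ i, ∑ j, (T i j x - v i x * v j x) * pd i (v j) x := by
    intro x
    have e0 := heq 0 x
    have e1 := heq 1 x
    have e2 := heq 2 x
    have hd := hdiv x
    simp only [lap3, Fin.sum_univ_three] at e0 e1 e2 hd
    simp only [hexp, Bt, Fin.sum_univ_three]
    linear_combination (θ x) * (v 0 x * e0 + v 1 x * e1 + v 2 x * e2) + hd * (θ x) *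
      (1/2 * (v 0 x * v 0 x + v 1 x * v 1 x + v 2 x * v 2 x) - Q x)
  have hiB : Integrable (fun x => Bt v T Q θ x) := by
    simp only [hBpt]
    refine (hiL.sub hDi).sub (hcθ ?_)
    have := fun i j => ((hv j).pd i).continuous
    have := fun i j => (hT i j).continuous
    have := fun i => (hv i).continuous
    fun_prop
  have hpt : ∀ x, θ x * ∑ i, ∑ j, (pd i (v j) x) ^ 2 ≤
      (θ x * ∑ i, ∑ j, (T i j x - v i x * v j x) ^ 2) + 2 * Bt v T Q θ x
      + 2 * ∑ i, ∑ j, pd i (W i j) x := by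
    intro x
    have key : 2 * ∑ i, ∑ j, (T i j x - v i x * v j x) * pd i (v j) x ≤
        ∑ i, ∑ j, (T i j x - v i x * v j x) ^ 2 + ∑ i, ∑ j, (pd i (v j) x) ^ 2 := by
      rw [Finset.mul_sum, ← Finset.sum_add_distrib]
      refine Finset.sum_le_sum fun i _ => ?_
      rw [Finset.mul_sum, ← Finset.sum_add_distrib]
      refine Finset.sum_le_sum fun j _ => ?_
      nlinarith [sq_nonneg (T i j x - v i x * v j x - pd i (v j) x)]
    have := mul_le_mul_of_nonneg_left key (hθ0 x)
    rw [hBpt]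
    linarith
  calc ∫ x, θ x * ∑ i, ∑ j, (pd i (v j) x) ^ 2 ≤ ∫ x, ((θ x * ∑ i, ∑ j, (T i j x - v i x * v j x) ^ 2)
        + 2 * Bt v T Q θ x + 2 * ∑ i, ∑ j, pd i (W i j) x) := by
        refine integral_mono hiL ((hiT.add (hiB.const_mul 2)).add (hDi.const_mul 2)) hpt
    _ = _ := by
        have hTB : Integrable (fun x => (θ x * ∑ i, ∑ j, (T i j x - v i x * v j x) ^ 2)
          + 2 * Bt v T Q θ x) := hiT.add (hiB.const_mul 2)
        rw [integral_add hTB (hDi.const_mul 2),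
          integral_add hiT (hiB.const_mul 2), integral_const_mul, integral_const_mul, hD]
        ring

/-- continuous sequences, uniformly bounded on a ball, converging a.e. -/
structure Good (R : ℝ) (f : ℕ → E3 → ℝ) (g : E3 → ℝ) : Prop where
  cont : ∀ n, Continuous (f n)
  tend : ∀ᵐ x, Tendsto (fun n => f n x) atTop (𝓝 (g x))
  bdd : ∃ M : ℝ, ∀ n, ∀ x ∈ ball (0:E3) R, |f n x| ≤ M

lemma Good.mul {R : ℝ} {f f' : ℕ → E3 → ℝ} {g g' : E3 → ℝ} (h : Good R f g) (h' : Good R f' g') :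
    Good R (fun n x => f n x * f' n x) (fun x => g x * g' x) where
  cont n := (h.cont n).mul (h'.cont n)
  tend := by filter_upwards [h.tend, h'.tend] with x h1 h2 using h1.mul h2
  bdd := by
    obtain ⟨M, hM⟩ := h.bdd
    obtain ⟨M', hM'⟩ := h'.bdd
    refine ⟨M * M', fun n x hx => ?_⟩
    rw [abs_mul]
    exact mul_le_mul (hM n x hx) (hM' n x hx) (abs_nonneg _) ((abs_nonneg _).trans (hM n x hx))

lemma Good.add {R : ℝ} {f f' : ℕ → E3 → ℝ} {g g' : E3 → ℝ} (h : Good R f g) (h' : Good R f' g') :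
    Good R (fun n x => f n x + f' n x) (fun x => g x + g' x) where
  cont n := (h.cont n).add (h'.cont n)
  tend := by filter_upwards [h.tend, h'.tend] with x h1 h2 using h1.add h2
  bdd := by
    obtain ⟨M, hM⟩ := h.bdd
    obtain ⟨M', hM'⟩ := h'.bdd
    exact ⟨M + M', fun n x hx => (abs_add_le _ _).trans (add_le_add (hM n x hx) (hM' n x hx))⟩

lemma Good.sub {R : ℝ} {f f' : ℕ → E3 → ℝ} {g g' : E3 → ℝ} (h : Good R f g) (h' : Good R f' g') :
    Good R (fun n x => f n x - f' n x) (fun x => g x - g' x) where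
  cont n := (h.cont n).sub (h'.cont n)
  tend := by filter_upwards [h.tend, h'.tend] with x h1 h2 using h1.sub h2
  bdd := by
    obtain ⟨M, hM⟩ := h.bdd
    obtain ⟨M', hM'⟩ := h'.bdd
    exact ⟨M + M', fun n x hx => (abs_sub _ _).trans (add_le_add (hM n x hx) (hM' n x hx))⟩

lemma Good.const {R : ℝ} {f : E3 → ℝ} (h : Continuous f) : Good R (fun _ => f) f where
  cont _ := h
  tend := ae_of_all _ fun _ => tendsto_const_nhds
  bdd := by
    obtain ⟨M, hM⟩ := (isCompact_closedBall (0:E3) R).exists_bound_of_continuousOn h.continuousOn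
    exact ⟨M, fun _ x hx => hM x (ball_subset_closedBall hx)⟩

lemma Good.sum {R : ℝ} {f : Fin 3 → ℕ → E3 → ℝ} {g : Fin 3 → E3 → ℝ} (h : ∀ i, Good R (f i) (g i)) :
    Good R (fun n x => ∑ i, f i n x) (fun x => ∑ i, g i x) := by
  simp only [Fin.sum_univ_three]
  exact ((h 0).add (h 1)).add (h 2)

lemma Good.int {R : ℝ} {f : ℕ → E3 → ℝ} {g : E3 → ℝ} (h : Good R f g)
    (h0 : ∀ n x, x ∉ ball (0:E3) R → f n x = 0) :
    Tendsto (fun n => ∫ x, f n x) atTop (𝓝 (∫ x, g x)) := by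
  obtain ⟨M, hM⟩ := h.bdd
  refine tendsto_integral_of_dominated_convergence ((ball (0:E3) R).indicator fun _ => M)
    (fun n => (h.cont n).aestronglyMeasurable) ?_ ?_ h.tend
  · rw [integrable_indicator_iff measurableSet_ball]
    exact integrableOn_const measure_ball_lt_top.ne
  · intro n
    refine ae_of_all _ fun x => ?_
    by_cases hx : x ∈ ball (0:E3) R
    · rw [Set.indicator_of_mem hx]; exact hM n x hx
    · rw [Set.indicator_of_notMem hx, h0 n x hx]; simp

lemma Good.mol {f : E3 → ℝ} (hf : LocallyIntegrable f)
    (hb : ∀ R : ℝ, ∃ M : ℝ, ∀ᵐ x, x ∈ ball (0:E3) R → |f x| ≤ M) (R : ℝ) :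
    Good R (fun n => mol (eta n) f) f where
  cont n := (mol_smo hf (eta_smo n) (eta_cs n)).continuous
  tend := mol_ae hf
  bdd := by
    obtain ⟨M, hM⟩ := hb (R + 1)
    exact ⟨M, fun n x hx => mol_bound hM n hx⟩

/-- cubic part of the energy flux -/
def Bc (v : Fin 3 → E3 → ℝ) (T : Fin 3 → Fin 3 → E3 → ℝ) (θ : E3 → ℝ) (x : E3) : ℝ :=
  ∑ i, ∑ j, (T i j x * v j x * pd i θ x - 1/2 * (v j x * v j x) * (v i x * pd i θ x)
    + 1/2 * (v j x * v j x) * pd i (pd i θ) x)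

/-- the energy flux -/
def En (u : E3 → E3) (P θ : E3 → ℝ) : ℝ :=
  (∫ x, Bc (fun j x => u x j) (fun i j x => u x i * u x j) θ x)
    + ∫ x, P x * ∑ i, u x i * pd i θ x

lemma P_lim {P : E3 → ℝ} (hP : LocallyIntegrable P) {R : ℝ} {f : ℕ → E3 → ℝ} {g : E3 → ℝ}
    (h : Good R f g) (h0 : ∀ n x, x ∉ ball (0:E3) R → f n x = 0) :
    Tendsto (fun n => ∫ x, mol (eta n) P x * f n x) atTop (𝓝 (∫ x, P x * g x)) := by
  obtain ⟨M, hM⟩ := h.bdd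
  have hcs : ∀ n, HasCompactSupport (f n) := fun n =>
    HasCompactSupport.intro (isCompact_closedBall (0:E3) R) fun x hx =>
      h0 n x fun hx' => hx (ball_subset_closedBall hx')
  have hs : ∀ n, Continuous (mol (eta n) P) := fun n =>
    (mol_smo hP (eta_smo n) (eta_cs n)).continuous
  have e : ∀ n, ∫ x, mol (eta n) P x * f n x = (∫ x, (mol (eta n) P x - P x) * f n x)
      + ∫ x, P x * f n x := by
    intro n
    rw [← integral_add]
    · congr 1; ext x; ring
    · exact int_mul_cs ((hs n).locallyIntegrable.sub hP) (h.cont n) (hcs n)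
    · exact int_mul_cs hP (h.cont n) (hcs n)
  simp only [e]
  rw [← zero_add (∫ x, P x * g x)]
  refine Tendsto.add ?_ ?_
  · rw [tendsto_zero_iff_enorm_tendsto_zero]
    have hl := ENNReal.Tendsto.mul_const (b := ENNReal.ofReal M) (mol_L1 hP R)
      (Or.inr ENNReal.ofReal_ne_top)
    rw [zero_mul] at hl
    refine tendsto_of_tendsto_of_tendsto_of_le_of_le tendsto_const_nhds hl (fun _ => zero_le) ?_
    intro n
    refine (enorm_integral_le_lintegral_enorm _).trans ?_
    simp only []
    rw [← lintegral_mul_const' _ _ ENNReal.ofReal_ne_top, ← lintegral_indicator measurableSet_ball]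
    refine lintegral_mono fun x => ?_
    by_cases hx : x ∈ ball (0:E3) R
    · rw [Set.indicator_of_mem hx, enorm_mul]
      gcongr
      rw [← ofReal_norm]
      exact ENNReal.ofReal_le_ofReal (hM n x hx)
    · rw [h0 n x hx]; simp
  · refine tendsto_integral_of_dominated_convergence
      ((closedBall (0:E3) R).indicator fun x => |P x| * |M|) (fun n => ?_) ?_ ?_ ?_
    · exact (int_mul_cs hP (h.cont n) (hcs n)).1
    · rw [integrable_indicator_iff measurableSet_closedBall]
      exact ((hP.integrableOn_isCompact (isCompact_closedBall _ _)).abs).mul_const |M|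
    · intro n
      refine ae_of_all _ fun x => ?_
      by_cases hx : x ∈ ball (0:E3) R
      · rw [Set.indicator_of_mem (ball_subset_closedBall hx), norm_mul, Real.norm_eq_abs]
        exact mul_le_mul_of_nonneg_left ((hM n x hx).trans (le_abs_self M)) (abs_nonneg _)
      · rw [h0 n x hx, mul_zero, norm_zero]
        by_cases hx2 : x ∈ closedBall (0:E3) R
        · rw [Set.indicator_of_mem hx2]
          positivity
        · rw [Set.indicator_of_notMem hx2]
    · filter_upwards [h.tend] with x hx using hx.const_mul _

lemma dual_bound {u : E3 → E3} {P : E3 → ℝ} (hw : IsWeakSolutionNS u P)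
    (hu1 : ∀ j, LocallyIntegrable (fun x => u x j))
    (hu2 : ∀ i j, LocallyIntegrable (fun x => u x i * u x j))
    (hP : LocallyIntegrable P)
    (hb : ∀ R : ℝ, ∃ M : ℝ, ∀ᵐ x, x ∈ ball (0:E3) R → ‖u x‖ ≤ M)
    {θ ψ : E3 → ℝ} (hθ : Smo θ) (hθc : HasCompactSupport θ) (hθ0 : ∀ x, 0 ≤ θ x)
    (hψ : Smo ψ) (hψc : HasCompactSupport ψ) (hθψ : ∀ x, ψ x ≠ 0 → 1 ≤ θ x)
    {τ : ℝ} (hτ : 0 < τ) (a b : Fin 3) :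
    |∫ x, u x b * pd a ψ x| ≤ En u P θ / τ + τ / 2 * ∫ x, ψ x ^ 2 := by
  obtain ⟨R, hR⟩ := (hθc.isCompact.union hψc.isCompact).isBounded.subset_ball 0
  have hθR : ∀ x, x ∉ ball (0:E3) R → x ∉ tsupport θ := fun x hx h => hx (hR (Or.inl h))
  have hψR : ∀ x, x ∉ ball (0:E3) R → x ∉ tsupport ψ := fun x hx h => hx (hR (Or.inr h))
  have hb1 : ∀ j, ∀ R : ℝ, ∃ M : ℝ, ∀ᵐ x, x ∈ ball (0:E3) R → |u x j| ≤ M := by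
    intro j R
    obtain ⟨M, hM⟩ := hb R
    refine ⟨M, ?_⟩
    filter_upwards [hM] with x hx hxR
    exact (PiLp.norm_apply_le (u x) j).trans (hx hxR)
  have hb2 : ∀ i j, ∀ R : ℝ, ∃ M : ℝ, ∀ᵐ x, x ∈ ball (0:E3) R → |u x i * u x j| ≤ M := by
    intro i j R
    obtain ⟨M, hM⟩ := hb1 i R
    obtain ⟨M', hM'⟩ := hb1 j R
    refine ⟨M * M', ?_⟩
    filter_upwards [hM, hM'] with x hx hx' hxR
    rw [abs_mul]
    exact mul_le_mul (hx hxR) (hx' hxR) (abs_nonneg _) ((abs_nonneg _).trans (hx hxR))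
  let v : ℕ → Fin 3 → E3 → ℝ := fun n j => mol (eta n) (fun x => u x j)
  let T : ℕ → Fin 3 → Fin 3 → E3 → ℝ := fun n i j => mol (eta n) (fun x => u x i * u x j)
  let Q : ℕ → E3 → ℝ := fun n => mol (eta n) P
  have hvs : ∀ n j, Smo (v n j) := fun n j => mol_smo (hu1 j) (eta_smo n) (eta_cs n)
  have hTs : ∀ n i j, Smo (T n i j) := fun n i j => mol_smo (hu2 i j) (eta_smo n) (eta_cs n)
  have hQs : ∀ n, Smo (Q n) := fun n => mol_smo hP (eta_smo n) (eta_cs n)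
  have gv : ∀ j, Good R (fun n => v n j) (fun x => u x j) := fun j => Good.mol (hu1 j) (hb1 j) R
  have gT : ∀ i j, Good R (fun n => T n i j) (fun x => u x i * u x j) := fun i j =>
    Good.mol (hu2 i j) (hb2 i j) R
  have gθ : Good R (fun _ => θ) θ := Good.const hθ.continuous
  have gθ1 : ∀ i, Good R (fun _ => pd i θ) (pd i θ) := fun i => Good.const (hθ.pd i).continuous
  have gθ2 : ∀ i, Good R (fun _ => pd i (pd i θ)) (pd i (pd i θ)) := fun i =>
    Good.const ((hθ.pd i).pd i).continuous
  have gc : Good R (fun _ _ => (1/2:ℝ)) (fun _ => 1/2) := Good.const continuous_const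
  -- the three limits
  have L1 : Tendsto (fun n => ∫ x, θ x * ∑ i, ∑ j, (T n i j x - v n i x * v n j x) ^ 2) atTop
      (𝓝 0) := by
    have g := gθ.mul (Good.sum fun i => Good.sum fun j =>
      ((gT i j).sub ((gv i).mul (gv j))).mul ((gT i j).sub ((gv i).mul (gv j))))
    have := g.int (fun n x hx => by
      rw [image_eq_zero_of_notMem_tsupport (hθR x hx), zero_mul])
    simpa [pow_two] using this
  have gB : Good R (fun n => Bc (v n) (T n) θ)
      (Bc (fun j x => u x j) (fun i j x => u x i * u x j) θ) := by
    unfold Bc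
    exact Good.sum fun i => Good.sum fun j =>
      ((((gT i j).mul (gv j)).mul (gθ1 i)).sub ((gc.mul ((gv j).mul (gv j))).mul
        ((gv i).mul (gθ1 i)))).add ((gc.mul ((gv j).mul (gv j))).mul (gθ2 i))
  have B0 : ∀ n x, x ∉ ball (0:E3) R → Bc (v n) (T n) θ x = 0 := by
    intro n x hx
    have h1 : ∀ i, pd i θ x = 0 := pd_off (hθR x hx)
    have h2 : ∀ i, pd i (pd i θ) x = 0 := fun i =>
      pd_off (fun h => hθR x hx (tsupport_pd θ i h)) i
    simp [Bc, h1, h2]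
  have L2 := gB.int B0
  have gG : Good R (fun n x => ∑ i, v n i x * pd i θ x) (fun x => ∑ i, u x i * pd i θ x) :=
    Good.sum fun i => (gv i).mul (gθ1 i)
  have G0 : ∀ n x, x ∉ ball (0:E3) R → ∑ i, v n i x * pd i θ x = 0 := by
    intro n x hx
    have h1 : ∀ i, pd i θ x = 0 := pd_off (hθR x hx)
    simp [h1]
  have L3 := P_lim hP gG G0
  have hcsx : ∀ {f : E3 → ℝ}, (∀ x, x ∉ ball (0:E3) R → f x = 0) → HasCompactSupport f :=
    fun hf => HasCompactSupport.intro (isCompact_closedBall (0:E3) R) fun x hx =>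
      hf x fun hx' => hx (ball_subset_closedBall hx')
  have hBsplit : ∀ n, ∫ x, Bt (v n) (T n) (Q n) θ x = (∫ x, Bc (v n) (T n) θ x)
      + ∫ x, Q n x * ∑ i, v n i x * pd i θ x := by
    intro n
    rw [← integral_add]
    · rfl
    · exact int_of_cs (gB.cont n) (hcsx (B0 n))
    · exact int_of_cs ((hQs n).continuous.mul (gG.cont n)) (hcsx fun x hx => by rw [G0 n x hx, mul_zero])
  have hen : ∀ n, ∫ x, θ x * ∑ i, ∑ j, (pd i (v n j) x) ^ 2 ≤
      (∫ x, θ x * ∑ i, ∑ j, (T n i j x - v n i x * v n j x) ^ 2) + 2 * ((∫ x, Bc (v n) (T n) θ x)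
      + ∫ x, Q n x * ∑ i, v n i x * pd i θ x) := by
    intro n
    rw [← hBsplit]
    exact energy (hvs n) (hTs n) (hQs n) hθ hθc hθ0
      (fun j x => mol_eqn hw hu1 hu2 hP (eta_smo n) (eta_cs n) j x)
      (fun x => mol_div hw hu1 (eta_smo n) (eta_cs n) x)
  have L4 : Tendsto (fun n => |∫ x, v n b x * pd a ψ x|) atTop (𝓝 |∫ x, u x b * pd a ψ x|) := by
    refine Tendsto.abs ?_
    refine ((gv b).mul (Good.const (hψ.pd a).continuous)).int fun n x hx => ?_
    rw [pd_off (hψR x hx), mul_zero]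
  have hLim := ((L1.add ((L2.add L3).const_mul 2)).mul_const (1 / (2 * τ))).add_const
    (τ / 2 * ∫ x, ψ x ^ 2)
  have hψ2 : Integrable (fun x => ψ x ^ 2) :=
    int_of_cs (hψ.continuous.pow 2) (hcsx fun x hx => by
      rw [image_eq_zero_of_notMem_tsupport (hψR x hx)]; simp)
  refine (le_of_tendsto_of_tendsto' L4 hLim fun n => ?_).trans (le_of_eq ?_)
  · rw [ibp (hvs n b) hψ hψc a, abs_neg]
    have hi1 : Integrable (fun x => θ x * ∑ i, ∑ j, (pd i (v n j) x) ^ 2) := by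
      refine int_of_cs (hθ.continuous.mul ?_) hθc.mul_right
      have := fun i j => ((hvs n j).pd i).continuous
      fun_prop
    have h1 : |∫ x, pd a (v n b) x * ψ x| ≤ ∫ x, ((θ x * ∑ i, ∑ j, (pd i (v n j) x) ^ 2) *
        (1 / (2 * τ)) + τ / 2 * ψ x ^ 2) := by
      rw [← Real.norm_eq_abs]
      refine norm_integral_le_of_norm_le ((hi1.mul_const _).add (hψ2.const_mul _)) ?_
      refine ae_of_all _ fun x => ?_
      rw [Real.norm_eq_abs]
      have hS : (pd a (v n b) x) ^ 2 ≤ ∑ i, ∑ j, (pd i (v n j) x) ^ 2 := by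
        refine le_trans ?_ (Finset.single_le_sum (f := fun i => ∑ j, (pd i (v n j) x) ^ 2)
          (fun i _ => Finset.sum_nonneg fun j _ => sq_nonneg _) (Finset.mem_univ a))
        exact Finset.single_le_sum (f := fun j => (pd a (v n j) x) ^ 2)
          (fun j _ => sq_nonneg _) (Finset.mem_univ b)
      have hS0 := (sq_nonneg _).trans hS
      by_cases h0 : ψ x = 0
      · rw [h0]; simp only [mul_zero, abs_zero]
        have := hθ0 x
        positivity
      · have ht := hθψ x h0
        have h2 : (pd a (v n b) x) ^ 2 ≤ θ x * ∑ i, ∑ j, (pd i (v n j) x) ^ 2 := by nlinarith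
        have h3 : |pd a (v n b) x * ψ x| ≤ (pd a (v n b) x) ^ 2 * (1 / (2 * τ)) + τ / 2 * ψ x ^ 2 := by
          have e : (pd a (v n b) x) ^ 2 * (1 / (2 * τ)) + τ / 2 * ψ x ^ 2 =
            (|pd a (v n b) x| ^ 2 + τ ^ 2 * |ψ x| ^ 2) / (2 * τ) := by
            rw [sq_abs, sq_abs]; field_simp
          rw [e, le_div_iff₀ (by positivity), abs_mul]
          nlinarith [sq_nonneg (|pd a (v n b) x| - τ * |ψ x|)]
        refine h3.trans ?_
        gcongr
    refine h1.trans ?_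
    rw [integral_add (hi1.mul_const _) (hψ2.const_mul _), integral_mul_const, integral_const_mul]
    gcongr
    exact hen n
  · unfold En; field_simp; ring

lemma setS_meas (γ : ℝ) : MeasurableSet (setS γ) := by
  unfold setS
  have h0 : Measurable fun x : E3 => x 0 := by fun_prop
  have h1 : Measurable fun x : E3 => x 1 := by fun_prop
  have h2 : Measurable fun x : E3 => x 2 := by fun_prop
  exact (measurableSet_lt measurable_const h0).inter
    (measurableSet_le ((h1.pow_const 2).add (h2.pow_const 2)) (h0.pow_const γ))

lemma setS_vol {γ : ℝ} (hγ0 : 0 < γ) {R : ℝ} (hR : 0 < R) :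
    volume (setS γ ∩ ball (0:E3) R) ≤ ENNReal.ofReal (4 * R ^ (1 + γ)) := by
  set s : ℝ := R ^ (γ / 2) with hs
  have hs0 : 0 < s := by positivity
  have hss : s ^ 2 = R ^ γ := by
    rw [hs, ← Real.rpow_natCast, ← Real.rpow_mul hR.le]; congr 1; push_cast; ring
  set B : Set (Fin 3 → ℝ) := Set.Icc ![0, -s, -s] ![R, s, s] with hB
  have hsub : setS γ ∩ ball (0:E3) R ⊆ (WithLp.ofLp : E3 → (Fin 3 → ℝ)) ⁻¹' B := by
    rintro x ⟨⟨hx0, hx⟩, hxR⟩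
    have hxn : ‖x‖ < R := by simpa using hxR
    have h0 : x 0 ≤ R := ((le_abs_self _).trans (PiLp.norm_apply_le x 0)).trans hxn.le
    have h3 : x 0 ^ γ ≤ R ^ γ := Real.rpow_le_rpow hx0.le h0 hγ0.le
    have h1 : |x 1| ≤ s := abs_le_of_sq_le_sq (by nlinarith [sq_nonneg (x 2)]) hs0.le
    have h2 : |x 2| ≤ s := abs_le_of_sq_le_sq (by nlinarith [sq_nonneg (x 1)]) hs0.le
    rw [abs_le] at h1 h2
    refine ⟨fun i => ?_, fun i => ?_⟩
    · fin_cases i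
      · exact hx0.le
      · exact h1.1
      · exact h2.1
    · fin_cases i
      · exact h0
      · exact h1.2
      · exact h2.2
  refine (measure_mono hsub).trans ?_
  rw [(PiLp.volume_preserving_ofLp (Fin 3)).measure_preimage measurableSet_Icc.nullMeasurableSet,
    Real.volume_Icc_pi, Fin.prod_univ_three]
  simp only [Matrix.cons_val]
  rw [← ENNReal.ofReal_mul (by linarith), ← ENNReal.ofReal_mul (by nlinarith)]
  apply ENNReal.ofReal_le_ofReal
  rw [Real.rpow_add hR, Real.rpow_one, ← hss]
  nlinarith

lemma pt_bound {w A p a : ℝ} (hw : 0 ≤ w) (hA : 0 < A) (hA1 : A ≤ 1) (hp : 3 ≤ p) (hpa : p ≤ a) :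
    w ^ (3:ℝ) ≤ A ^ (3:ℝ) + A ^ (3 - a) * w ^ p := by
  rcases le_or_gt w A with h | h
  · have : w ^ (3:ℝ) ≤ A ^ (3:ℝ) := Real.rpow_le_rpow hw h (by norm_num)
    have h2 : 0 ≤ A ^ (3 - a) * w ^ p := by positivity
    linarith
  · have hw0 : 0 < w := hA.trans h
    have e : w ^ (3:ℝ) = w ^ (3 - p) * w ^ p := by
      rw [← Real.rpow_add hw0]; congr 1; ring
    have h1 : w ^ (3 - p) ≤ A ^ (3 - p) := Real.rpow_le_rpow_of_nonpos hA h.le (by linarith)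
    have h2 : A ^ (3 - p) ≤ A ^ (3 - a) :=
      Real.rpow_le_rpow_of_exponent_ge hA hA1 (by linarith)
    have h3 : 0 ≤ A ^ (3:ℝ) := by positivity
    rw [e]
    have := mul_le_mul_of_nonneg_right (h1.trans h2) (by positivity : 0 ≤ w ^ p)
    linarith

/-- exponent assumptions, in a.e. form -/
structure ExpOK (γ : ℝ) (p : E3 → ℝ) (a b : ℝ) : Prop where
  γ0 : 0 < γ
  γ1 : γ < 1
  ha3 : 3 < a
  ha : a < 9 / 2
  hb3 : 3 < b
  hb : b < (6 * γ + 3) / (2 * γ)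
  lo : ∀ᵐ x, 3 ≤ p x
  out : ∀ᵐ x, x ∉ setS γ → p x ≤ a
  inn : ∀ᵐ x, x ∈ setS γ → p x ≤ b

lemma tend_pow {c e : ℝ} (he : e < 0) : Tendsto (fun R : ℝ => c * R ^ e) atTop (𝓝 0) := by
  have h := (tendsto_rpow_neg_atTop (y := -e) (by linarith)).const_mul c
  simpa using h

lemma core_decay {γ : ℝ} {p : E3 → ℝ} {a b : ℝ} (H : ExpOK γ p a b) {w : E3 → ℝ}
    (hw0 : ∀ x, 0 ≤ w x) (hp : Measurable p) (hwm : Measurable w)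
    (hw : ∫⁻ x, ENNReal.ofReal (w x ^ p x) ≤ 1) :
    Tendsto (fun R : ℝ => ENNReal.ofReal R⁻¹ * ∫⁻ x in ball (0:E3) (2 * R),
      ENNReal.ofReal (w x ^ (3:ℝ))) atTop (𝓝 0) := by
  have hγ0 := H.γ0
  obtain ⟨α, hα1, hα2⟩ : ∃ α : ℝ, 2 / 3 < α ∧ α < 1 / (a - 3) := by
    apply exists_between
    rw [lt_div_iff₀ (by linarith [H.ha3])]; linarith [H.ha]
  have hα2' : α * (a - 3) < 1 := by
    rwa [lt_div_iff₀ (by linarith [H.ha3])] at hα2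
  set β := γ / 2 with hβ
  have hβb : β * (b - 3) < 1 := by
    have := H.hb
    rw [lt_div_iff₀ (by linarith)] at this
    rw [hβ]; nlinarith
  set V := (volume (ball (0:E3) 1)).toReal with hV
  set h : ℝ → ℝ := fun R => (8 * V) * R ^ (2 - 3 * α) + 1 * R ^ (α * (a - 3) - 1)
    + (4 * 2 ^ (1 + γ)) * R ^ (γ - 3 * β) + 1 * R ^ (β * (b - 3) - 1) with hh
  have hlim : Tendsto h atTop (𝓝 0) := by
    have := (((tend_pow (c := 8 * V) (e := 2 - 3 * α) (by linarith)).add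
      (tend_pow (c := 1) (e := α * (a - 3) - 1) (by linarith))).add
      (tend_pow (c := 4 * 2 ^ (1 + γ)) (e := γ - 3 * β) (by rw [hβ]; linarith))).add
      (tend_pow (c := 1) (e := β * (b - 3) - 1) (by linarith))
    simpa [hh] using this
  have hlim2 : Tendsto (fun R => ENNReal.ofReal (h R)) atTop (𝓝 0) := by
    simpa using ENNReal.tendsto_ofReal hlim
  refine tendsto_of_tendsto_of_tendsto_of_le_of_le' tendsto_const_nhds hlim2
    (Eventually.of_forall fun _ => zero_le) ?_
  filter_upwards [eventually_ge_atTop 1] with R hR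
  have hR0 : 0 < R := by linarith
  set A := R ^ (-α) with hA
  set D := R ^ (-β) with hD
  have hA0 : 0 < A := by positivity
  have hD0 : 0 < D := by positivity
  have hA1 : A ≤ 1 := Real.rpow_le_one_of_one_le_of_nonpos hR (by linarith)
  have hD1 : D ≤ 1 := Real.rpow_le_one_of_one_le_of_nonpos hR (by rw [hβ]; linarith)
  have hWm : Measurable fun x => ENNReal.ofReal (w x ^ p x) := (hwm.pow hp).ennreal_ofReal
  have hpt : ∀ᵐ x : E3, ENNReal.ofReal (w x ^ (3:ℝ)) ≤
      ENNReal.ofReal (A ^ (3:ℝ)) + ENNReal.ofReal (A ^ (3 - a)) * ENNReal.ofReal (w x ^ p x)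
      + (setS γ).indicator (fun _ => ENNReal.ofReal (D ^ (3:ℝ))) x
      + ENNReal.ofReal (D ^ (3 - b)) * ENNReal.ofReal (w x ^ p x) := by
    filter_upwards [H.lo, H.out, H.inn] with x h1 h2 h3
    have hwp : 0 ≤ w x ^ p x := Real.rpow_nonneg (hw0 x) _
    by_cases hx : x ∈ setS γ
    · rw [Set.indicator_of_mem hx, add_assoc]
      refine le_trans ?_ le_add_self
      rw [← ENNReal.ofReal_mul (by positivity), ← ENNReal.ofReal_add (by positivity) (by positivity)]
      exact ENNReal.ofReal_le_ofReal (pt_bound (hw0 x) hD0 hD1 h1 (h3 hx))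
    · rw [add_assoc]
      refine le_trans ?_ le_self_add
      rw [← ENNReal.ofReal_mul (by positivity), ← ENNReal.ofReal_add (by positivity) (by positivity)]
      exact ENNReal.ofReal_le_ofReal (pt_bound (hw0 x) hA0 hA1 h1 (h2 hx))
  have hvol : volume (ball (0:E3) (2 * R)) = ENNReal.ofReal ((2 * R) ^ 3 * V) := by
    rw [Measure.addHaar_ball _ _ (by linarith), ENNReal.ofReal_mul (by positivity), hV,
      ENNReal.ofReal_toReal measure_ball_lt_top.ne]
    simp
  have hle : ∫⁻ x in ball (0:E3) (2 * R), ENNReal.ofReal (w x ^ (3:ℝ)) ≤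
      ENNReal.ofReal (A ^ (3:ℝ) * ((2 * R) ^ 3 * V) + A ^ (3 - a)
        + D ^ (3:ℝ) * (4 * (2 * R) ^ (1 + γ)) + D ^ (3 - b)) := by
    refine (lintegral_mono_ae (ae_restrict_of_ae hpt)).trans ?_
    rw [lintegral_add_left' , lintegral_add_left', lintegral_add_left']
    · have i1 : ∫⁻ x in ball (0:E3) (2 * R), ENNReal.ofReal (w x ^ p x) ≤ 1 :=
        (setLIntegral_le_lintegral _ _).trans hw
      rw [ENNReal.ofReal_add (by positivity) (by positivity),
        ENNReal.ofReal_add (by positivity) (by positivity),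
        ENNReal.ofReal_add (by positivity) (by positivity)]
      gcongr
      · rw [lintegral_const, Measure.restrict_apply_univ, hvol, ← ENNReal.ofReal_mul (by positivity)]
      · rw [lintegral_const_mul _ hWm]
        exact mul_le_of_le_one_right' i1
      · rw [lintegral_indicator (setS_meas γ), lintegral_const, Measure.restrict_apply_univ,
          Measure.restrict_apply (setS_meas γ), ENNReal.ofReal_mul (by positivity)]
        gcongr
        exact setS_vol hγ0 (by linarith)
      · rw [lintegral_const_mul _ hWm]
        exact mul_le_of_le_one_right' i1
    · fun_prop
    · fun_prop
    · apply Measurable.aemeasurable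
      exact (measurable_const.add (hWm.const_mul _)).add (measurable_const.indicator (setS_meas γ))
  refine (mul_le_mul_right hle _).trans ?_
  rw [← ENNReal.ofReal_mul (by positivity)]
  apply ENNReal.ofReal_le_ofReal
  apply le_of_eq
  have eR : R⁻¹ = R ^ (-1:ℝ) := by rw [Real.rpow_neg_one]
  have eA3 : A ^ (3:ℝ) = R ^ (-3 * α) := by
    rw [hA, ← Real.rpow_mul hR0.le]; congr 1; ring
  have eD3 : D ^ (3:ℝ) = R ^ (-3 * β) := by
    rw [hD, ← Real.rpow_mul hR0.le]; congr 1; ring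
  have eAa : A ^ (3 - a) = R ^ (α * (a - 3)) := by
    rw [hA, ← Real.rpow_mul hR0.le]; congr 1; ring
  have eDb : D ^ (3 - b) = R ^ (β * (b - 3)) := by
    rw [hD, ← Real.rpow_mul hR0.le]; congr 1; ring
  have e3 : R ^ 3 = R ^ (3:ℝ) := by norm_cast
  rw [eR, eA3, eD3, eAa, eDb, mul_pow, e3, Real.mul_rpow (by norm_num) hR0.le, hh]
  simp only []
  rw [show (2 - 3 * α) = (-1) + ((-3 * α) + 3) by ring,
    show (α * (a - 3) - 1) = (-1) + α * (a - 3) by ring,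
    show (γ - 3 * β) = (-1) + ((-3 * β) + (1 + γ)) by ring,
    show (β * (b - 3) - 1) = (-1) + β * (b - 3) by ring]
  simp only [Real.rpow_add hR0]
  ring

/-- basic cutoff -/
def chi : ContDiffBump (0:E3) where
  rIn := 1
  rOut := 3 / 2
  rIn_pos := by norm_num
  rIn_lt_rOut := by norm_num

/-- rescaled cutoff -/
def th (R : ℝ) (x : E3) : ℝ := chi (R⁻¹ • x)

lemma chi_smo : Smo (chi : E3 → ℝ) := chi.contDiff
lemma th_smo (R : ℝ) : Smo (th R) := chi_smo.comp_smul R⁻¹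
lemma th_nonneg (R : ℝ) (x : E3) : 0 ≤ th R x := chi.nonneg
lemma th_cs {R : ℝ} (hR : 0 < R) : HasCompactSupport (th R) :=
  chi.hasCompactSupport.comp_smul (inv_ne_zero hR.ne')
lemma th_one {R : ℝ} (hR : 0 < R) {x : E3} (hx : ‖x‖ ≤ R) : th R x = 1 := by
  refine chi.one_of_mem_closedBall ?_
  rw [mem_closedBall, dist_zero_right, norm_smul, norm_inv, Real.norm_of_nonneg hR.le,
    inv_mul_le_iff₀ hR]
  simpa [chi] using hx

lemma chi_pd_off {z : E3} (hz : 2 ≤ ‖z‖) : z ∉ tsupport (chi : E3 → ℝ) := by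
  rw [chi.tsupport_eq, mem_closedBall, dist_zero_right]
  have : chi.rOut = 3 / 2 := rfl
  rw [this]; linarith

lemma th_bounds : ∃ C : ℝ, 0 < C ∧ ∀ R : ℝ, 0 < R → ∀ (i : Fin 3) (x : E3),
    |pd i (th R) x| ≤ C / R ∧ |pd i (pd i (th R)) x| ≤ C / R ^ 2 ∧
    (x ∉ ball (0:E3) (2 * R) → pd i (th R) x = 0 ∧ pd i (pd i (th R)) x = 0) := by
  have h1 : ∀ i : Fin 3, ∃ C : ℝ, ∀ x, |pd i (chi : E3 → ℝ) x| ≤ C := fun i =>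
    (chi_smo.pd i).continuous.bounded_above_of_compact_support (cs_pd chi.hasCompactSupport i)
  have h2 : ∀ i : Fin 3, ∃ C : ℝ, ∀ x, |pd i (pd i (chi : E3 → ℝ)) x| ≤ C := fun i =>
    ((chi_smo.pd i).pd i).continuous.bounded_above_of_compact_support
      (cs_pd (cs_pd chi.hasCompactSupport i) i)
  choose C1 hC1 using h1
  choose C2 hC2 using h2
  refine ⟨∑ i, |C1 i| + ∑ i, |C2 i| + 1, by positivity, fun R hR i x => ?_⟩
  have e1 : pd i (th R) = fun z => R⁻¹ * pd i (chi : E3 → ℝ) (R⁻¹ • z) :=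
    pd_comp_smul chi_smo R⁻¹ i
  have e2 : pd i (pd i (th R)) = fun z => (R⁻¹ * R⁻¹) * pd i (pd i (chi : E3 → ℝ)) (R⁻¹ • z) := by
    rw [e1, pd_scal (chi_smo.pd i)]
  have s1 : |C1 i| ≤ ∑ i, |C1 i| := Finset.single_le_sum (f := fun i => |C1 i|)
    (fun _ _ => abs_nonneg _) (Finset.mem_univ i)
  have s2 : |C2 i| ≤ ∑ i, |C2 i| := Finset.single_le_sum (f := fun i => |C2 i|)
    (fun _ _ => abs_nonneg _) (Finset.mem_univ i)
  have p1 : 0 ≤ ∑ i, |C1 i| := by positivity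
  have p2 : 0 ≤ ∑ i, |C2 i| := by positivity
  refine ⟨?_, ?_, ?_⟩
  · rw [e1]
    simp only []
    rw [abs_mul, abs_of_pos (inv_pos.2 hR), div_eq_inv_mul]
    gcongr
    linarith [hC1 i (R⁻¹ • x), le_abs_self (C1 i)]
  · rw [e2]
    simp only []
    rw [abs_mul, abs_of_pos (by positivity), div_eq_inv_mul, pow_two, mul_inv]
    gcongr
    linarith [hC2 i (R⁻¹ • x), le_abs_self (C2 i)]
  · intro hx
    have hz : 2 ≤ ‖R⁻¹ • x‖ := by
      rw [mem_ball, dist_zero_right, not_lt] at hx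
      rw [norm_smul, norm_inv, Real.norm_of_nonneg hR.le, le_inv_mul_iff₀ hR]
      linarith
    have := chi_pd_off hz
    rw [e2, e1]
    simp only []
    rw [pd_off this, pd_off (fun h => this (tsupport_pd _ i h))]
    simp

lemma enorm_le_ofReal {t s : ℝ} (h : |t| ≤ s) : ‖t‖ₑ ≤ ENNReal.ofReal s := by
  rw [← ofReal_norm]; exact ENNReal.ofReal_le_ofReal h

lemma En_bound {u : E3 → E3} {P : E3 → ℝ} (hu : Measurable u) (hPm : Measurable P) :
    ∃ K : ℝ, 0 < K ∧ ∀ R : ℝ, 1 ≤ R →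
    ‖En u P (th R)‖ₑ ≤ ENNReal.ofReal K * ((ENNReal.ofReal R⁻¹ * ∫⁻ x in ball (0:E3) (2 * R),
        ENNReal.ofReal (‖u x‖ ^ (3:ℝ))) + (ENNReal.ofReal R⁻¹ * ∫⁻ x in ball (0:E3) (2 * R),
        ENNReal.ofReal ((√|P x|) ^ (3:ℝ))) +
        ENNReal.ofReal (R⁻¹ ^ 4) * volume (ball (0:E3) (2 * R))) := by
  obtain ⟨C, hC, hth⟩ := th_bounds
  refine ⟨21 * C, by positivity, fun R hR => ?_⟩
  have hR0 : 0 < R := by linarith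
  have hUm : Measurable fun x => ENNReal.ofReal (‖u x‖ ^ (3:ℝ)) :=
    (hu.norm.pow_const _).ennreal_ofReal
  have hQm : Measurable fun x => ENNReal.ofReal ((√|P x|) ^ (3:ℝ)) := by
    refine Measurable.ennreal_ofReal (Measurable.pow_const ?_ _)
    exact (continuous_abs.measurable.comp hPm).sqrt
  have b1 : ∀ x, ‖Bc (fun j x => u x j) (fun i j x => u x i * u x j) (th R) x‖ₑ ≤
      (ball (0:E3) (2 * R)).indicator (fun x => ENNReal.ofReal (18 * C) *
        (ENNReal.ofReal R⁻¹ * ENNReal.ofReal (‖u x‖ ^ (3:ℝ)) + ENNReal.ofReal (R⁻¹ ^ 4))) x := by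
    intro x
    by_cases hx : x ∈ ball (0:E3) (2 * R)
    · rw [Set.indicator_of_mem hx, ← ENNReal.ofReal_mul (by positivity),
        ← ENNReal.ofReal_add (by positivity) (by positivity), ← ENNReal.ofReal_mul (by positivity)]
      apply enorm_le_ofReal
      set U := ‖u x‖ with hU
      have hU0 : 0 ≤ U := norm_nonneg _
      have hui : ∀ i, |u x i| ≤ U := fun i => PiLp.norm_apply_le (u x) i
      have e3 : U ^ (3:ℝ) = U ^ 3 := by norm_cast
      rw [e3]
      have hterm : ∀ i j : Fin 3, |u x i * u x j * u x j * pd i (th R) x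
          - 1/2 * (u x j * u x j) * (u x i * pd i (th R) x)
          + 1/2 * (u x j * u x j) * pd i (pd i (th R)) x| ≤
          2 * C * (R⁻¹ * U ^ 3 + R⁻¹ ^ 4) := by
        intro i j
        obtain ⟨t1, t2, -⟩ := hth R hR0 i x
        have q1 : |u x i * u x j * u x j * pd i (th R) x| ≤ U * U * U * (C / R) := by
          rw [abs_mul, abs_mul, abs_mul]; gcongr <;> apply hui
        have q2 : |1/2 * (u x j * u x j) * (u x i * pd i (th R) x)| ≤ 1/2 * (U * U) * (U * (C / R)) := by
          rw [abs_mul, abs_mul, abs_mul, abs_mul, abs_of_pos (by norm_num : (0:ℝ) < 1/2)]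
          gcongr <;> apply hui
        have q3 : |1/2 * (u x j * u x j) * pd i (pd i (th R)) x| ≤ 1/2 * (U * U) * (C / R ^ 2) := by
          rw [abs_mul, abs_mul, abs_mul, abs_of_pos (by norm_num : (0:ℝ) < 1/2)]
          gcongr <;> apply hui
        have q4 : U * U * R⁻¹ ^ 2 ≤ R⁻¹ * U ^ 3 + R⁻¹ ^ 4 := by
          set r := R⁻¹
          have hr : 0 < r := inv_pos.2 hR0
          rcases le_total r U with h | h
          · have : 0 ≤ (U - r) * (U * U * r) := mul_nonneg (by linarith) (by positivity)
            nlinarith [pow_pos hr 4]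
          · have : U * U ≤ r * r := mul_le_mul h h hU0 hr.le
            have h2 : U * U * r ^ 2 ≤ r * r * r ^ 2 := by gcongr
            have h3 : 0 ≤ r * U ^ 3 := by positivity
            nlinarith
        refine (abs_add_le _ _).trans ?_
        refine (add_le_add (abs_sub _ _) le_rfl).trans ?_
        have hx3 : 0 ≤ R⁻¹ * U ^ 3 := by positivity
        have hx4 : 0 ≤ R⁻¹ ^ 4 := by positivity
        have k1 : U * U * U * (C / R) = C * (R⁻¹ * U ^ 3) := by field_simp
        have k2 : 1/2 * (U * U) * (U * (C / R)) = 1/2 * (C * (R⁻¹ * U ^ 3)) := by field_simp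
        have k3 : 1/2 * (U * U) * (C / R ^ 2) = 1/2 * (C * (U * U * R⁻¹ ^ 2)) := by field_simp
        rw [k1] at q1; rw [k2] at q2; rw [k3] at q3
        have q5 := mul_le_mul_of_nonneg_left q4 hC.le
        nlinarith
      unfold Bc
      calc _ ≤ ∑ i : Fin 3, ∑ j : Fin 3, 2 * C * (R⁻¹ * U ^ 3 + R⁻¹ ^ 4) := by
            refine (Finset.abs_sum_le_sum_abs _ _).trans (Finset.sum_le_sum fun i _ => ?_)
            exact (Finset.abs_sum_le_sum_abs _ _).trans (Finset.sum_le_sum fun j _ => hterm i j)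
        _ = _ := by simp; ring
    · have h1 : ∀ i, pd i (th R) x = 0 := fun i => ((hth R hR0 i x).2.2 hx).1
      have h2 : ∀ i, pd i (pd i (th R)) x = 0 := fun i => ((hth R hR0 i x).2.2 hx).2
      simp [Bc, h1, h2]
  have b2 : ∀ x, ‖P x * ∑ i, u x i * pd i (th R) x‖ₑ ≤
      (ball (0:E3) (2 * R)).indicator (fun x => ENNReal.ofReal (3 * C) *
        (ENNReal.ofReal R⁻¹ * ENNReal.ofReal (‖u x‖ ^ (3:ℝ)) +
          ENNReal.ofReal R⁻¹ * ENNReal.ofReal ((√|P x|) ^ (3:ℝ)))) x := by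
    intro x
    by_cases hx : x ∈ ball (0:E3) (2 * R)
    · rw [Set.indicator_of_mem hx, ← ENNReal.ofReal_mul (by positivity),
        ← ENNReal.ofReal_mul (by positivity),
        ← ENNReal.ofReal_add (by positivity) (by positivity), ← ENNReal.ofReal_mul (by positivity)]
      apply enorm_le_ofReal
      set U := ‖u x‖ with hU
      have hU0 : 0 ≤ U := norm_nonneg _
      have hui : ∀ i, |u x i| ≤ U := fun i => PiLp.norm_apply_le (u x) i
      have e3 : ∀ t : ℝ, t ^ (3:ℝ) = t ^ 3 := fun t => by norm_cast
      rw [e3, e3]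
      set q := √|P x| with hq
      have hq0 : 0 ≤ q := Real.sqrt_nonneg _
      have hPq : |P x| = q * q := (Real.mul_self_sqrt (abs_nonneg _)).symm
      have hs : |∑ i, u x i * pd i (th R) x| ≤ 3 * (U * (C / R)) := by
        calc _ ≤ ∑ i : Fin 3, U * (C / R) := by
              refine (Finset.abs_sum_le_sum_abs _ _).trans (Finset.sum_le_sum fun i _ => ?_)
              rw [abs_mul]
              exact mul_le_mul (hui i) (hth R hR0 i x).1 (abs_nonneg _) hU0
          _ = _ := by simp
      rw [abs_mul, hPq]
      have hqU : q * q * U ≤ U ^ 3 + q ^ 3 := by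
        rcases le_total q U with h | h
        · have : q * q ≤ U * U := mul_le_mul h h hq0 hU0
          have h2 : 0 ≤ q ^ 3 := by positivity
          nlinarith
        · have h2 : 0 ≤ U ^ 3 := by positivity
          have := mul_le_mul_of_nonneg_left h (by positivity : 0 ≤ q * q)
          nlinarith
      calc q * q * _ ≤ q * q * (3 * (U * (C / R))) := by gcongr
        _ = 3 * C * (R⁻¹ * (q * q * U)) := by field_simp
        _ ≤ 3 * C * (R⁻¹ * (U ^ 3 + q ^ 3)) := by gcongr
        _ = _ := by ring
    · have h1 : ∀ i, pd i (th R) x = 0 := fun i => ((hth R hR0 i x).2.2 hx).1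
      simp [h1]
  unfold En
  refine (enorm_add_le _ _).trans ?_
  have i1 := (enorm_integral_le_lintegral_enorm (μ := (volume : Measure E3)) _).trans (lintegral_mono b1)
  have i2 := (enorm_integral_le_lintegral_enorm (μ := (volume : Measure E3)) _).trans (lintegral_mono b2)
  refine (add_le_add i1 i2).trans ?_
  rw [lintegral_indicator measurableSet_ball, lintegral_indicator measurableSet_ball,
    lintegral_const_mul' _ _ ENNReal.ofReal_ne_top, lintegral_const_mul' _ _ ENNReal.ofReal_ne_top,
    lintegral_add_right _ measurable_const, lintegral_add_left (hUm.const_mul _),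
    lintegral_const_mul' _ _ ENNReal.ofReal_ne_top, lintegral_const_mul' _ _ ENNReal.ofReal_ne_top,
    lintegral_const, Measure.restrict_apply_univ]
  set X := ENNReal.ofReal R⁻¹ * ∫⁻ x in ball (0:E3) (2 * R), ENNReal.ofReal (‖u x‖ ^ (3:ℝ))
  set Y := ENNReal.ofReal R⁻¹ * ∫⁻ x in ball (0:E3) (2 * R), ENNReal.ofReal ((√|P x|) ^ (3:ℝ))
  set Z := ENNReal.ofReal (R⁻¹ ^ 4) * volume (ball (0:E3) (2 * R))
  have e : ENNReal.ofReal (21 * C) = ENNReal.ofReal (18 * C) + ENNReal.ofReal (3 * C) := by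
    rw [← ENNReal.ofReal_add (by positivity) (by positivity)]; congr 1; ring
  rw [e]
  calc ENNReal.ofReal (18 * C) * (X + Z) + ENNReal.ofReal (3 * C) * (X + Y)
      ≤ ENNReal.ofReal (18 * C) * (X + Y + Z) + ENNReal.ofReal (3 * C) * (X + Y + Z) := by
        refine add_le_add (mul_le_mul_right ?_ _) (mul_le_mul_right le_self_add _)
        exact add_le_add le_self_add le_rfl
    _ = _ := by rw [add_mul]

lemma decay_scaled {γ a b : ℝ} {p f : E3 → ℝ} (H : ExpOK γ p a b) (hp : Measurable p)
    (hf : Measurable f) (hf0 : ∀ x, 0 ≤ f x) {l : ℝ} (hl : 0 < l)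
    (h : ∫⁻ x, ENNReal.ofReal ((f x / l) ^ p x) ≤ 1) :
    Tendsto (fun R : ℝ => ENNReal.ofReal R⁻¹ *
      ∫⁻ x in ball (0:E3) (2 * R), ENNReal.ofReal (f x ^ (3:ℝ))) atTop (𝓝 0) := by
  have h1 := core_decay H (w := fun x => f x / l) (fun x => div_nonneg (hf0 x) hl.le) hp
    (hf.div_const l) h
  have h2 := ENNReal.Tendsto.const_mul (a := ENNReal.ofReal (l ^ (3:ℝ))) h1
    (Or.inr ENNReal.ofReal_ne_top)
  rw [mul_zero] at h2
  refine h2.congr fun R => ?_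
  rw [mul_left_comm, ← lintegral_const_mul' _ _ ENNReal.ofReal_ne_top]
  congr 2; ext x
  rw [← ENNReal.ofReal_mul (by positivity), ← Real.mul_rpow hl.le (div_nonneg (hf0 x) hl.le)]
  congr 2; field_simp

lemma vol_decay : Tendsto (fun R : ℝ => ENNReal.ofReal (R⁻¹ ^ 4) * volume (ball (0:E3) (2 * R)))
    atTop (𝓝 0) := by
  have h1 : Tendsto (fun R : ℝ => ENNReal.ofReal (8 * R⁻¹) * volume (ball (0:E3) 1)) atTop
      (𝓝 (ENNReal.ofReal (8 * 0) * volume (ball (0:E3) 1))) := by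
    refine ENNReal.Tendsto.mul_const ?_ (Or.inr measure_ball_lt_top.ne)
    exact ENNReal.tendsto_ofReal (tendsto_inv_atTop_zero.const_mul 8)
  rw [mul_zero, ENNReal.ofReal_zero, zero_mul] at h1
  refine h1.congr' ?_
  filter_upwards [eventually_gt_atTop 0] with R hR
  rw [Measure.addHaar_ball _ _ (by positivity : (0:ℝ) ≤ 2 * R), ← mul_assoc,
    ← ENNReal.ofReal_mul (by positivity)]
  congr 2
  simp
  field_simp
  norm_num

lemma En_tend {γ a b : ℝ} {p : E3 → ℝ} (H : ExpOK γ p a b) (hp : Measurable p)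
    {u : E3 → E3} {P : E3 → ℝ} (hu : Measurable u) (hPm : Measurable P)
    (hu_p : MemVarLp p (fun x => ‖u x‖)) (hP_p : MemVarLp (fun x => p x / 2) P) :
    Tendsto (fun R : ℝ => ENNReal.ofReal R⁻¹ *
      ∫⁻ x in ball (0:E3) (2 * R), ENNReal.ofReal (‖u x‖ ^ (3:ℝ))) atTop (𝓝 0) ∧
    Tendsto (fun R : ℝ => En u P (th R)) atTop (𝓝 0) := by
  obtain ⟨l, hl, h1⟩ := hu_p
  obtain ⟨m, hm, h2⟩ := hP_p
  have t1 := decay_scaled H hp hu.norm (fun x => norm_nonneg _) hl (by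
    refine le_trans (le_of_eq ?_) h1
    unfold modularV
    congr 1; ext x
    rw [abs_of_nonneg (div_nonneg (norm_nonneg _) hl.le)])
  have t2 := decay_scaled H hp (f := fun x => √|P x|) (by fun_prop) (fun x => Real.sqrt_nonneg _)
    (Real.sqrt_pos.2 hm) (by
    refine le_trans (le_of_eq ?_) h2
    unfold modularV
    congr 1; ext x
    rw [← Real.sqrt_div (abs_nonneg _), abs_div, abs_of_pos hm, Real.sqrt_eq_rpow,
      ← Real.rpow_mul (by positivity)]
    congr 2; ring)
  refine ⟨t1, ?_⟩
  obtain ⟨K, hK, hE⟩ := En_bound hu hPm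
  rw [tendsto_zero_iff_enorm_tendsto_zero]
  have t3 := ENNReal.Tendsto.const_mul (a := ENNReal.ofReal K) ((t1.add t2).add vol_decay)
    (Or.inr ENNReal.ofReal_ne_top)
  simp only [add_zero, mul_zero] at t3
  refine tendsto_of_tendsto_of_tendsto_of_le_of_le' tendsto_const_nhds t3
    (Eventually.of_forall fun _ => zero_le) ?_
  filter_upwards [eventually_ge_atTop 1] with R hR
  exact hE R hR

lemma weak_grad_zero {u : E3 → E3} {P : E3 → ℝ} (hw : IsWeakSolutionNS u P)
    (hu1 : ∀ j, LocallyIntegrable (fun x => u x j))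
    (hu2 : ∀ i j, LocallyIntegrable (fun x => u x i * u x j))
    (hP : LocallyIntegrable P)
    (hb : ∀ R : ℝ, ∃ M : ℝ, ∀ᵐ x, x ∈ ball (0:E3) R → ‖u x‖ ≤ M)
    (hE : Tendsto (fun R : ℝ => En u P (th R)) atTop (𝓝 0))
    {ψ : E3 → ℝ} (hψ : Smo ψ) (hψc : HasCompactSupport ψ) (a b : Fin 3) :
    ∫ x, u x b * pd a ψ x = 0 := by
  have key : ∀ τ : ℝ, 0 < τ → |∫ x, u x b * pd a ψ x| ≤ τ / 2 * ∫ x, ψ x ^ 2 := by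
    intro τ hτ
    have ht : Tendsto (fun R : ℝ => En u P (th R) / τ + τ / 2 * ∫ x, ψ x ^ 2) atTop
        (𝓝 (0 / τ + τ / 2 * ∫ x, ψ x ^ 2)) := (hE.div_const τ).add_const _
    rw [zero_div, zero_add] at ht
    obtain ⟨R0, hR0⟩ := hψc.isCompact.isBounded.exists_norm_le
    refine ge_of_tendsto ht ?_
    filter_upwards [eventually_ge_atTop R0, eventually_gt_atTop 0] with R hR hRp
    refine dual_bound hw hu1 hu2 hP hb (th_smo R) (th_cs hRp) (th_nonneg R) hψ hψc ?_ hτ a b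
    intro x hx
    rw [th_one hRp ((hR0 x (subset_tsupport _ hx)).trans hR)]
  have ht : Tendsto (fun τ : ℝ => τ / 2 * ∫ x, ψ x ^ 2) (𝓝[>] 0) (𝓝 (0 / 2 * ∫ x, ψ x ^ 2)) :=
    (((continuous_id.div_const 2).mul_const _).tendsto 0).mono_left nhdsWithin_le_nhds
  rw [zero_div, zero_mul] at ht
  have := ge_of_tendsto ht (eventually_mem_nhdsWithin.mono fun τ hτ => key τ hτ)
  exact abs_nonpos_iff.1 this

lemma ae_const_of_grad {f : E3 → ℝ} (hf : LocallyIntegrable f)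
    (h : ∀ ψ : E3 → ℝ, Smo ψ → HasCompactSupport ψ → ∀ a, ∫ x, f x * pd a ψ x = 0) :
    ∃ k : ℝ, ∀ᵐ x, f x = k := by
  have hc : ∀ n x y, mol (eta n) f x = mol (eta n) f y := by
    intro n
    have hs := mol_smo hf (eta_smo n) (eta_cs n)
    refine is_const_of_fderiv_eq_zero (𝕜 := ℝ) (hs.differentiable (by simp)) fun x => ?_
    have hz : ∀ i, fderiv ℝ (mol (eta n) f) x (EuclideanSpace.single i 1) = 0 := by
      intro i
      have e := congrFun (mol_pd hf (eta_smo n) (eta_cs n) i) x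
      have h0 := h _ ((eta_smo n).comp_rsub x) (cs_comp_rsub (eta_cs n) x) i
      rw [pd_comp_rsub (eta_smo n)] at h0
      simp only [mul_neg, integral_neg, neg_eq_zero] at h0
      unfold pd at e
      rw [e]; exact h0
    have : (fderiv ℝ (mol (eta n) f) x : E3 →ₗ[ℝ] ℝ) = 0 := by
      refine (EuclideanSpace.basisFun (Fin 3) ℝ).toBasis.ext fun i => ?_
      simpa using hz i
    ext v
    exact LinearMap.congr_fun this v
  have hae := mol_ae hf
  obtain ⟨x0, hx0⟩ := hae.exists
  refine ⟨f x0, ?_⟩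
  filter_upwards [hae] with x hx
  refine tendsto_nhds_unique hx (hx0.congr fun n => hc n x0 x)

lemma const_zero {u : E3 → E3} {k : E3} (hk : ∀ᵐ x, u x = k)
    (t : Tendsto (fun R : ℝ => ENNReal.ofReal R⁻¹ *
      ∫⁻ x in ball (0:E3) (2 * R), ENNReal.ofReal (‖u x‖ ^ (3:ℝ))) atTop (𝓝 0)) : k = 0 := by
  by_contra hk0
  have hkn : 0 < ‖k‖ ^ (3:ℝ) := Real.rpow_pos_of_pos (norm_pos_iff.2 hk0) _
  have hlow : ENNReal.ofReal (‖k‖ ^ (3:ℝ)) * volume (ball (0:E3) 1) ≤ 0 := by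
    refine ge_of_tendsto t ?_
    filter_upwards [eventually_ge_atTop 1] with R hR
    have e : ∫⁻ x in ball (0:E3) (2 * R), ENNReal.ofReal (‖u x‖ ^ (3:ℝ)) =
        ENNReal.ofReal (‖k‖ ^ (3:ℝ)) * volume (ball (0:E3) (2 * R)) := by
      rw [← setLIntegral_const]
      refine lintegral_congr_ae (ae_restrict_of_ae ?_)
      filter_upwards [hk] with x hx
      rw [hx]
    rw [e, Measure.addHaar_ball _ _ (by positivity : (0:ℝ) ≤ 2 * R), mul_left_comm, ← mul_assoc (ENNReal.ofReal R⁻¹),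
      ← ENNReal.ofReal_mul (by positivity)]
    refine mul_le_mul_right ?_ _
    refine le_mul_of_one_le_left (zero_le) ?_
    rw [ENNReal.one_le_ofReal]
    simp only [finrank_euclideanSpace, Fintype.card_fin]
    have : R⁻¹ * (2 * R) ^ 3 = 8 * R ^ 2 := by field_simp; ring
    rw [this]; nlinarith
  have := nonpos_iff_eq_zero.1 hlow
  rw [mul_eq_zero, ENNReal.ofReal_eq_zero] at this
  rcases this with h | h
  · linarith
  · exact (measure_ball_pos volume (0:E3) one_pos).ne' h

lemma ess_lo {p : E3 → ℝ} {μ : Measure E3} {c : ℝ} (h0 : 0 ≤ c) (h : c < essInf p μ) :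
    ∃ q, c < q ∧ ∀ᵐ x ∂μ, q ≤ p x := by
  rw [essInf, liminf_eq] at h
  have hne : {a | ∀ᶠ n in ae μ, a ≤ p n}.Nonempty := by
    by_contra hh
    rw [Set.not_nonempty_iff_eq_empty] at hh
    rw [hh, Real.sSup_empty] at h
    linarith
  obtain ⟨q, hq, hcq⟩ := exists_lt_of_lt_csSup hne h
  exact ⟨q, hcq, hq⟩

lemma ess_hi {p : E3 → ℝ} {μ : Measure E3} {c : ℝ} (h0 : 0 < essSup p μ) (h : essSup p μ < c) :
    ∃ q, q < c ∧ ∀ᵐ x ∂μ, p x ≤ q := by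
  rw [essSup, limsup_eq] at h h0
  have hne : {a | ∀ᶠ n in ae μ, p n ≤ a}.Nonempty := by
    by_contra hh
    rw [Set.not_nonempty_iff_eq_empty] at hh
    rw [hh, Real.sInf_empty] at h0
    linarith
  obtain ⟨q, hq, hcq⟩ := exists_lt_of_csInf_lt hne h
  exact ⟨q, hcq, hq⟩

lemma lq_point {t l q p : ℝ} (ht : 0 ≤ t) (hl : 0 < l) (hq : 0 < q) (hqp : q ≤ p) :
    (1 + t) ^ q ≤ (1 + l) ^ q * (1 + (t / l) ^ p) := by
  have hs : 0 ≤ t / l := by positivity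
  have hp0 : 0 ≤ (t / l) ^ p := Real.rpow_nonneg hs _
  have hl0 : 0 ≤ (1 + l) ^ q := by positivity
  rcases le_total (t / l) 1 with h | h
  · have h1 : t ≤ l := (div_le_one hl).1 h
    calc (1 + t) ^ q ≤ (1 + l) ^ q := Real.rpow_le_rpow (by positivity) (by linarith) hq.le
      _ ≤ _ := le_mul_of_one_le_right hl0 (by linarith)
  · have h1 : 1 + t ≤ (1 + l) * (t / l) := by
      have : l * (t / l) = t := by field_simp
      nlinarith
    calc (1 + t) ^ q ≤ ((1 + l) * (t / l)) ^ q := Real.rpow_le_rpow (by positivity) h1 hq.le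
      _ = (1 + l) ^ q * (t / l) ^ q := Real.mul_rpow (by positivity) hs
      _ ≤ _ := by
        refine mul_le_mul_of_nonneg_left ?_ hl0
        have := Real.rpow_le_rpow_of_exponent_le h hqp
        linarith

lemma lq_loc {u : E3 → E3} {p : E3 → ℝ} {q : ℝ} (hq : 0 < q) (hqp : ∀ᵐ x, q ≤ p x)
    (hu_p : MemVarLp p (fun x => ‖u x‖)) (R : ℝ) :
    ∫⁻ y in ball (0:E3) R, (1 + ‖u y‖ₑ) ^ q ≠ ∞ := by
  obtain ⟨l, hl, h⟩ := hu_p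
  have h1 : ∫⁻ y in ball (0:E3) R, (1 + ‖u y‖ₑ) ^ q ≤
      ∫⁻ y in ball (0:E3) R, ENNReal.ofReal ((1 + l) ^ q) *
        (1 + ENNReal.ofReal (|‖u y‖ / l| ^ p y)) := by
    refine lintegral_mono_ae (ae_restrict_of_ae ?_)
    filter_upwards [hqp] with x hx
    have e : (1 + ‖u x‖ₑ) ^ q = ENNReal.ofReal ((1 + ‖u x‖) ^ q) := by
      rw [← ofReal_norm, ← ENNReal.ofReal_one, ← ENNReal.ofReal_add zero_le_one (norm_nonneg _),
        ENNReal.ofReal_rpow_of_nonneg (by positivity) hq.le]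
    have hn : 0 ≤ |‖u x‖ / l| ^ p x := by positivity
    rw [e, ← ENNReal.ofReal_one, ← ENNReal.ofReal_add zero_le_one hn,
      ← ENNReal.ofReal_mul (by positivity)]
    refine ENNReal.ofReal_le_ofReal ?_
    rw [abs_of_nonneg (by positivity)]
    exact lq_point (norm_nonneg _) hl hq hx
  refine ne_top_of_le_ne_top ?_ h1
  rw [lintegral_const_mul' _ _ ENNReal.ofReal_ne_top, lintegral_add_left measurable_const]
  refine ENNReal.mul_ne_top ENNReal.ofReal_ne_top (ENNReal.add_ne_top.2 ⟨?_, ?_⟩)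
  · rw [setLIntegral_const]; exact ENNReal.mul_ne_top ENNReal.one_ne_top measure_ball_lt_top.ne
  · refine ne_top_of_le_ne_top ENNReal.one_ne_top ((setLIntegral_le_lintegral _ _).trans h)

lemma main_aux {γ a b q : ℝ} {p : E3 → ℝ} (H : ExpOK γ p a b) (hp : Measurable p)
    (hq : 3 < q) (hqp : ∀ᵐ x, q ≤ p x)
    {u : E3 → E3} {P : E3 → ℝ} (hu_meas : Measurable u) (hP_meas : Measurable P)
    (hu_loc : LocallyIntegrable (fun x => ‖u x‖ ^ 2) volume)
    (hP_loc : LocallyIntegrable P volume)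
    (hweak : IsWeakSolutionNS u P)
    (hu_p : MemVarLp p (fun x => ‖u x‖))
    (hP_p : MemVarLp (fun x => p x / 2) P) :
    ∀ᵐ x : E3, u x = 0 := by
  have hcm : ∀ j, Measurable (fun x => u x j) := fun j => by fun_prop
  have hcn : ∀ x j, |u x j| ≤ ‖u x‖ := fun x j => PiLp.norm_apply_le (u x) j
  have hu1 : ∀ j, LocallyIntegrable (fun x => u x j) := by
    intro j
    refine ((locallyIntegrable_const (1:ℝ)).add hu_loc).mono (hcm j).aestronglyMeasurable
      (ae_of_all _ fun x => ?_)
    simp only [Pi.add_apply, Real.norm_eq_abs]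
    rw [abs_of_nonneg (by positivity : 0 ≤ 1 + ‖u x‖ ^ 2)]
    nlinarith [hcn x j, sq_nonneg (‖u x‖ - 1)]
  have hu2 : ∀ i j, LocallyIntegrable (fun x => u x i * u x j) := by
    intro i j
    refine hu_loc.mono ((hcm i).mul (hcm j)).aestronglyMeasurable (ae_of_all _ fun x => ?_)
    rw [Real.norm_eq_abs, Real.norm_eq_abs, abs_mul, abs_of_nonneg (by positivity : 0 ≤ ‖u x‖ ^ 2), sq]
    exact mul_le_mul (hcn x i) (hcn x j) (abs_nonneg _) (norm_nonneg _)
  obtain ⟨C, hC, hJ⟩ := pointwise hweak hu1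
  have hbt := boot (g := fun x => 1 + ‖u x‖ₑ) (by fun_prop) (fun x => le_self_add) hC hJ hq
    (lq_loc (by linarith) hqp hu_p)
  have hb : ∀ R : ℝ, ∃ M : ℝ, ∀ᵐ x, x ∈ ball (0:E3) R → ‖u x‖ ≤ M := by
    intro R
    obtain ⟨M, hM, h⟩ := hbt R
    refine ⟨M.toReal, ?_⟩
    filter_upwards [h] with x hx hxR
    have h2 : ‖u x‖ₑ ≤ M := le_add_self.trans (hx hxR)
    have := ENNReal.toReal_mono hM h2
    simpa using this
  obtain ⟨t1, t2⟩ := En_tend H hp hu_meas hP_meas hu_p hP_p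
  have hk : ∀ j, ∃ k : ℝ, ∀ᵐ x, u x j = k := fun j =>
    ae_const_of_grad (hu1 j) fun ψ hψ hψc a =>
      weak_grad_zero hweak hu1 hu2 hP_loc hb t2 hψ hψc a j
  choose k hk using hk
  have hk' : ∀ᵐ x, u x = WithLp.toLp 2 k := by
    filter_upwards [ae_all_iff.2 hk] with x hx
    ext j
    exact hx j
  have h0 := const_zero hk' t1
  filter_upwards [hk'] with x hx
  rw [hx, h0]

/-- **Theorem 2.** Liouville theorem for the stationary Navier–Stokes equations with a
variable exponent adapted to the region `𝒮`. -/
theorem liouville_NS_paraboloid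
    (γ : ℝ) (hγ0 : 0 < γ) (hγ1 : γ < 1)
    (p : E3 → ℝ) (hpmeas : Measurable p) (hp1 : ∀ x, 1 ≤ p x)
    (hout_lb : (3 : ℝ) < essInf p (volume.restrict (setS γ)ᶜ))
    (hout_le : essInf p (volume.restrict (setS γ)ᶜ) ≤ essSup p (volume.restrict (setS γ)ᶜ))
    (hout_ub : essSup p (volume.restrict (setS γ)ᶜ) < 9 / 2)
    (hin_lb : (9 / 2 : ℝ) < essInf p (volume.restrict (setS γ)))
    (hin_le : essInf p (volume.restrict (setS γ)) ≤ essSup p (volume.restrict (setS γ)))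
    (hin_ub : essSup p (volume.restrict (setS γ)) < (6 * γ + 3) / (2 * γ))
    (u : E3 → E3) (P : E3 → ℝ)
    (hu_meas : Measurable u) (hP_meas : Measurable P)
    (hu_loc : LocallyIntegrable (fun x => ‖u x‖ ^ 2) volume)
    (hP_loc : LocallyIntegrable P volume)
    (hweak : IsWeakSolutionNS u P)
    (hu_p : MemVarLp p (fun x => ‖u x‖))
    (hP_p : MemVarLp (fun x => p x / 2) P) :
    ∀ᵐ x : E3, u x = 0 := by
  obtain ⟨q1, hq1, l1⟩ := ess_lo (by norm_num) hout_lb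
  obtain ⟨q2, hq2, l2⟩ := ess_lo (by norm_num) hin_lb
  obtain ⟨a, ha, l3⟩ := ess_hi (by linarith) hout_ub
  obtain ⟨b, hb, l4⟩ := ess_hi (by linarith) hin_ub
  rw [ae_restrict_iff' (setS_meas γ)] at l2 l4
  rw [ae_restrict_iff' (setS_meas γ).compl] at l1 l3
  have hlo : ∀ᵐ x, min q1 q2 ≤ p x := by
    filter_upwards [l1, l2] with x h1 h2
    by_cases hx : x ∈ setS γ
    · exact (min_le_right _ _).trans (h2 hx)
    · exact (min_le_left _ _).trans (h1 hx)
  have hq : 3 < min q1 q2 := lt_min hq1 (by linarith)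
  have H : ExpOK γ p (max a 4) (max b 4) :=
    { γ0 := hγ0
      γ1 := hγ1
      ha3 := lt_max_of_lt_right (by norm_num)
      ha := max_lt ha (by norm_num)
      hb3 := lt_max_of_lt_right (by norm_num)
      hb := max_lt hb (by linarith)
      lo := hlo.mono fun x hx => hq.le.trans hx
      out := l3.mono fun x hx hxS => (hx hxS).trans (le_max_left _ _)
      inn := l4.mono fun x hx hxS => (hx hxS).trans (le_max_left _ _) }
  exact main_aux H hpmeas hq hlo hu_meas hP_meas hu_loc hP_loc hweak hu_p hP_p
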